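/- arXiv:math/0612091 — 5 statements merged into one kernel-verified Lean document; each statement's English description precedes it below -/
import Mathlib

section
/- Let A be a ℂ-algebra and let a, b ∈ A with a² = b² = 0. If a·b is algebraic over ℚ, then the subgroup ⟨1+a, 1+b⟩ of the unit group of A is nilpotent if and only if 0 is the only complex root of the minimal polynomial of a·b over ℂ (i.e. 0 is the only eigenvalue of a·b). -/
theorem nilp_of_filtration {A : Type*} [Ring A] [Algebra ℂ A] (T : ℕ → Submodule ℂ A)
    (h1 : (1 : A) ∈ T 0) (hanti : ∀ k, T (k + 1) ≤ T k)
    (hmul : ∀ j k x y, x ∈ T j → y ∈ T k → x * y ∈ T (j + k))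
    (N : ℕ) (hN : T N = ⊥) (G : Subgroup Aˣ)
    (hG : ∀ g ∈ G, (g : A) - 1 ∈ T 1) : Group.IsNilpotent G := by
  have h0 : ∀ g ∈ G, (g : A) ∈ T 0 := fun g hg => by
    have := (T 0).add_mem (hanti 0 (hG g hg)) h1
    simpa using this
  have hr : ∀ k x, ∀ g ∈ G, x ∈ T k → x * (g : A) ∈ T k := fun k x g hg hx => by
    simpa using hmul k 0 x g hx (h0 g hg)
  rw [Subgroup.nilpotent_iff_finite_descending_central_series]
  let H : ℕ → Subgroup G := fun k =>
    { carrier := {g | (((g : Aˣ) : A) - 1) ∈ T (k + 1)}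
      one_mem' := by simp
      mul_mem' := by
        intro x y hx hy
        simp only [Set.mem_ofPred_eq] at *
        have := (T (k + 1)).add_mem (hr _ _ y y.2 hx) hy
        convert this using 1
        push_cast
        noncomm_ring
      inv_mem' := by
        intro x hx
        simp only [Set.mem_ofPred_eq] at *
        have := (T (k + 1)).neg_mem (hr _ _ _ (x⁻¹).2 hx)
        convert this using 1
        simp [sub_mul] }
  have hH : ∀ k (g : G), g ∈ H k ↔ (((g : Aˣ) : A) - 1) ∈ T (k + 1) := fun _ _ => Iff.rfl
  refine ⟨N, H, ⟨?_, ?_⟩, ?_⟩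
  · ext g
    simp [hH, hG g g.2]
  · intro x n hx g
    rw [hH] at *
    have e1 := hmul _ _ _ _ hx (hG g g.2)
    have e2 := hmul _ _ _ _ (hG g g.2) hx
    rw [add_comm 1] at e2
    have := hr _ _ _ (g⁻¹).2 (hr _ _ _ (x⁻¹).2 ((T _).sub_mem e1 e2))
    convert this using 1
    have e : ((x : Aˣ) : A) * ((g : Aˣ) : A) - ((g : Aˣ) : A) * ((x : Aˣ) : A) =
      (((x : Aˣ) : A) - 1) * (((g : Aˣ) : A) - 1) - (((g : Aˣ) : A) - 1) * (((x : Aˣ) : A) - 1) := by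
      noncomm_ring
    rw [← e, sub_mul, sub_mul]
    simp [commutatorElement_def, mul_assoc]
  · rw [eq_bot_iff]
    intro g hg
    rw [hH] at hg
    have := hanti N hg
    rw [hN, Submodule.mem_bot, sub_eq_zero] at this
    rw [Subgroup.mem_bot]
    ext
    simpa using this

theorem nilp_of_pow {A : Type*} [Ring A] [Algebra ℂ A]
    (a b : A) (ha : a ^ 2 = 0) (hb : b ^ 2 = 0) (n : ℕ) (hn : (a * b) ^ n = 0)
    (α β : Aˣ) (hα : (α : A) = 1 + a) (hβ : (β : A) = 1 + b) :
    Group.IsNilpotent ↥(Subgroup.closure {α, β}) := by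
  have haa : a * a = 0 := by rw [← sq, ha]
  have hbb : b * b = 0 := by rw [← sq, hb]
  let M : Submodule ℂ A := Submodule.span ℂ {a, b}
  let T : ℕ → Submodule ℂ A := fun k => ⨆ i : ℕ, M ^ (i + k)
  have hT : ∀ k, T k = ⨆ i : ℕ, M ^ (i + k) := fun _ => rfl
  have hle : ∀ i k, k ≤ i → M ^ i ≤ T k := fun i k h => by
    have := le_iSup (fun i : ℕ => M ^ (i + k)) (i - k)
    simpa [Nat.sub_add_cancel h] using this
  have hanti : ∀ k, T (k + 1) ≤ T k := fun k => iSup_le fun i => hle _ _ (by omega)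
  have h1 : (1 : A) ∈ T 0 := hle 0 0 le_rfl (by rw [pow_zero]; exact Submodule.one_le.1 le_rfl)
  have hmul : ∀ j k x y, x ∈ T j → y ∈ T k → x * y ∈ T (j + k) := by
    intro j k x y hx hy
    have : T j * T k ≤ T (j + k) := by
      rw [hT j, hT k, Submodule.iSup_mul]
      refine iSup_le fun i => ?_
      rw [Submodule.mul_iSup]
      refine iSup_le fun l => ?_
      rw [← pow_add]
      exact hle _ _ (by omega)
    exact this (Submodule.mul_mem_mul hx hy)
  have hM2 : M ^ 2 ≤ Submodule.span ℂ {a * b, b * a} := by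
    rw [sq, Submodule.span_mul_span, Submodule.span_le]
    rintro _ ⟨x, hx, y, hy, rfl⟩
    simp only [Set.mem_insert_iff, Set.mem_singleton_iff] at hx hy
    rcases hx with rfl | rfl <;> rcases hy with rfl | rfl
    · simp [haa]
    · exact Submodule.subset_span (by simp)
    · exact Submodule.subset_span (by simp)
    · simp [hbb]
  have hMp : ∀ k : ℕ, M ^ (2 * (k + 1)) ≤
      Submodule.span ℂ {(a * b) ^ (k + 1), (b * a) ^ (k + 1)} := by
    intro k
    induction k with
    | zero => simpa using hM2
    | succ k ih =>
      have : M ^ (2 * (k + 1 + 1)) = M ^ (2 * (k + 1)) * M ^ 2 := by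
        rw [← pow_add]; congr 1
      rw [this]
      refine (mul_le_mul' ih hM2).trans ?_
      rw [Submodule.span_mul_span, Submodule.span_le]
      rintro _ ⟨x, hx, y, hy, rfl⟩
      simp only [Set.mem_insert_iff, Set.mem_singleton_iff] at hx hy
      rcases hx with rfl | rfl <;> rcases hy with rfl | rfl
      · exact Submodule.subset_span (by simp [← pow_succ])
      · have : (a * b) ^ (k + 1) * (b * a) = 0 := by
          rw [pow_succ, mul_assoc, mul_assoc a b, ← mul_assoc b b, hbb]; simp
        simp [this]
      · have : (b * a) ^ (k + 1) * (a * b) = 0 := by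
          rw [pow_succ, mul_assoc, mul_assoc b a, ← mul_assoc a a, haa]; simp
        simp [this]
      · exact Submodule.subset_span (by simp [← pow_succ])
  have hab : (a * b) ^ (n + 1) = 0 := by rw [pow_succ, hn, zero_mul]
  have hba' : ∀ k : ℕ, (b * a) ^ (k + 1) = b * (a * b) ^ k * a := by
    intro k
    induction k with
    | zero => simp
    | succ k ih => rw [pow_succ, ih, pow_succ]; simp only [mul_assoc]
  have hba : (b * a) ^ (n + 1) = 0 := by rw [hba', hn]; simp
  have hM0 : M ^ (2 * (n + 1)) = ⊥ := by
    have := hMp n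
    rw [hab, hba] at this
    simpa using this
  have hN : T (2 * (n + 1)) = ⊥ := by
    rw [eq_bot_iff]
    refine iSup_le fun i => ?_
    rw [pow_add, hM0, Submodule.mul_bot]
  have hM1 : M ≤ T 1 := by simpa using hle 1 1 le_rfl
  have haT : a ∈ T 1 := hM1 (Submodule.subset_span (by simp))
  have hbT : b ∈ T 1 := hM1 (Submodule.subset_span (by simp))
  refine nilp_of_filtration T h1 hanti hmul _ hN _ ?_
  intro g hg
  have hinv : ∀ (g : Aˣ) (c : A), c * c = 0 → (g : A) = 1 + c → ((g⁻¹ : Aˣ) : A) = 1 - c := by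
    intro g c hc hg
    rw [Units.inv_eq_of_mul_eq_one_right]
    rw [hg]
    noncomm_ring
    simp [hc]
  have key : ((g : A) - 1 ∈ T 1) ∧ (((g⁻¹ : Aˣ) : A) - 1 ∈ T 1) := by
    have hm : ∀ x y : A, x - 1 ∈ T 1 → y - 1 ∈ T 1 → x * y - 1 ∈ T 1 := by
      intro x y hx hy
      have := (T 1).add_mem ((T 1).add_mem (hanti 1 (hmul _ _ _ _ hx hy)) hx) hy
      convert this using 1
      noncomm_ring
    induction hg using Subgroup.closure_induction with
    | mem x hx =>
      rcases hx with rfl | rfl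
      · rw [hinv _ a haa hα, hα]; simp [haT]
      · rw [hinv _ b hbb hβ, hβ]; simp [hbT]
    | one => simp
    | mul x y _ _ hx hy =>
      rw [mul_inv_rev]
      push_cast
      exact ⟨hm _ _ hx.1 hy.1, hm _ _ hy.2 hx.2⟩
    | inv x _ hx => simpa using hx.symm
  exact key.1

theorem not_nilp {A : Type*} [Ring A] [Algebra ℂ A]
    (a b v : A) (l : ℂ) (ha : a ^ 2 = 0) (hb : b ^ 2 = 0) (hv : v ≠ 0) (hl : l ≠ 0)
    (hav : a * b * v = l • v)
    (α β : Aˣ) (hα : (α : A) = 1 + a) (hβ : (β : A) = 1 + b)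
    (h : Group.IsNilpotent ↥(Subgroup.closure {α, β})) : False := by
  have haa : a * a = 0 := by rw [← sq, ha]
  have hbb : b * b = 0 := by rw [← sq, hb]
  rw [Subgroup.nilpotent_iff_finite_descending_central_series] at h
  obtain ⟨n, H, ⟨h0, hs⟩, hn⟩ := h
  obtain ⟨w, hw⟩ : ∃ w, w = b * v := ⟨_, rfl⟩
  have haw : a * w = l • v := by rw [hw, ← mul_assoc, hav]
  have hbw : b * w = 0 := by rw [hw, ← mul_assoc, hbb, zero_mul]
  have hav0 : a * v = 0 := by
    have : l • (a * v) = 0 := by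
      rw [← mul_smul_comm, ← haw, ← mul_assoc, haa, zero_mul]
    exact (smul_eq_zero.1 this).resolve_left hl
  have cancel : ∀ (g : Aˣ) (x y : A), (g : A) * x = y → ((g⁻¹ : Aˣ) : A) * y = x := by
    rintro g x y rfl
    simp
  have hαv : ((α⁻¹ : Aˣ) : A) * v = v := cancel _ _ _ (by rw [hα, add_mul, hav0]; simp)
  have hαw : ((α⁻¹ : Aˣ) : A) * w = w - l • v := cancel _ _ _ (by
    rw [hα, add_mul, mul_sub a, haw, mul_smul_comm, hav0]; simp)
  have hαv' : (α : A) * v = v := by rw [hα, add_mul, hav0]; simp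
  have hαw' : (α : A) * w = w + l • v := by rw [hα, add_mul, haw]; simp
  have key : ∀ k : ℕ, ∃ g : Subgroup.closure {α, β}, g ∈ H k ∧ ∃ p q r s : ℂ, r ≠ 0 ∧
      p * s - q * r = 1 ∧ ((g : Aˣ) : A) * v = p • v + r • w ∧
      ((g : Aˣ) : A) * w = q • v + s • w := by
    intro k
    induction k with
    | zero =>
      refine ⟨⟨β, Subgroup.subset_closure (by simp)⟩, by simp [h0], 1, 0, 1, 1, one_ne_zero,
        by simp, ?_, ?_⟩
      · simp [hβ, add_mul, hw]
      · simp [hβ, add_mul, hbw]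
    | succ k ih =>
      obtain ⟨g, hg, p, q, r, s, hr, hd, gv, gw⟩ := ih
      let α' : Subgroup.closure {α, β} := ⟨α, Subgroup.subset_closure (by simp)⟩
      have giv : (((g : Aˣ)⁻¹ : Aˣ) : A) * v = s • v - r • w := cancel _ _ _ (by
        rw [mul_sub, mul_smul_comm, mul_smul_comm, gv, gw]
        linear_combination (norm := module) hd • v)
      have giw : (((g : Aˣ)⁻¹ : Aˣ) : A) * w = p • w - q • v := cancel _ _ _ (by
        rw [mul_sub, mul_smul_comm, mul_smul_comm, gv, gw]
        linear_combination (norm := module) hd • w)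
      have cv : ((g * α' * g⁻¹ * α'⁻¹ : Subgroup.closure {α, β}) : Aˣ) = g * (α * ((g : Aˣ)⁻¹ * α⁻¹)) := by
        simp [α', mul_assoc]
      refine ⟨g * α' * g⁻¹ * α'⁻¹, hs _ _ hg α', 1 - l * p * r, l * p * p - l * (1 - l * p * r), -l * r ^ 2,
        1 + l * p * r + l * l * r ^ 2, ?_, ?_, ?_, ?_⟩
      · simp [hl, hr]
      · ring
      · rw [cv]
        simp only [Units.val_mul, mul_assoc]
        rw [hαv, giv]
        simp only [mul_sub, mul_add, mul_smul_comm, hαv', hαw', gv, gw]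
        linear_combination (norm := module) hd • v
      · rw [cv]
        simp only [Units.val_mul, mul_assoc]
        rw [hαw]
        simp only [mul_sub, mul_add, mul_smul_comm, giv, giw, hαv', hαw', gv, gw]
        linear_combination (norm := module) hd • w - (l * hd) • v
  obtain ⟨g, hg, p, q, r, s, hr, hd, gv, gw⟩ := key n
  rw [hn, Subgroup.mem_bot] at hg
  subst hg
  have : a * (((1 : Subgroup.closure {α, β}) : Aˣ) : A) * v = (r * l) • v := by
    rw [mul_assoc, gv, mul_add, mul_smul_comm, mul_smul_comm, hav0, haw, smul_smul]; simp
  rw [Subgroup.coe_one, Units.val_one, mul_one, hav0] at this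
  exact (smul_ne_zero (mul_ne_zero hr hl) hv) this.symm



/-- **Corollary 3.1(3), second part.** Let `A` be a `ℂ`-algebra and `a, b ∈ A` with
`a² = b² = 0`. If `ab` is algebraic over `ℚ` (viewing `A` as a `ℚ`-algebra via
`ℚ → ℂ → A`), then the subgroup `⟨1 + a, 1 + b⟩` of the unit group of `A` is
nilpotent if and only if `0` is the only complex root of the minimal polynomial of
`ab` over `ℂ` (i.e. `0` is the only eigenvalue of `ab`). -/
theorem nilpotent_group_iff_zero_only_eigenvalue (A : Type*) [Ring A] [Algebra ℂ A]
    (a b : A) (ha : a ^ 2 = 0) (hb : b ^ 2 = 0)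
    (halg : ∃ p : Polynomial ℚ, p ≠ 0 ∧
      Polynomial.eval₂ ((algebraMap ℂ A).comp (algebraMap ℚ ℂ)) (a * b) p = 0)
    (α β : Aˣ) (hα : (α : A) = 1 + a) (hβ : (β : A) = 1 + b) :
    Group.IsNilpotent ↥(Subgroup.closure {α, β}) ↔
      ∀ lam : ℂ, (minpoly ℂ (a * b)).IsRoot lam → lam = 0 := by
  have hInteg : IsIntegral ℂ (a * b) := by
    obtain ⟨p, hp, he⟩ := halg
    refine IsAlgebraic.isIntegral ⟨p.map (algebraMap ℚ ℂ), ?_, ?_⟩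
    · exact (Polynomial.map_ne_zero_iff (algebraMap ℚ ℂ).injective).2 hp
    · rw [Polynomial.aeval_def, Polynomial.eval₂_map]
      exact he
  constructor
  · intro h lam hlam
    by_contra hl
    obtain ⟨q, hq⟩ := Polynomial.dvd_iff_isRoot.2 hlam
    have hm := minpoly.monic hInteg
    have hqm : q.Monic := by
      rw [hq] at hm
      exact (Polynomial.monic_X_sub_C lam).of_mul_monic_left hm
    have hne : Polynomial.aeval (a * b) q ≠ 0 := by
      refine minpoly.aeval_ne_zero_of_dvdNotUnit_minpoly hInteg hqm
        ⟨hqm.ne_zero, Polynomial.X - Polynomial.C lam, Polynomial.not_isUnit_X_sub_C lam, ?_⟩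
      rw [hq, mul_comm]
    refine not_nilp a b (Polynomial.aeval (a * b) q) lam ha hb hne hl ?_ α β hα hβ h
    have := minpoly.aeval ℂ (a * b)
    rw [hq, map_mul, map_sub, Polynomial.aeval_X, Polynomial.aeval_C, sub_mul, sub_eq_zero] at this
    rw [this, Algebra.smul_def]
  · intro h
    have hp := (IsAlgClosed.splits (minpoly ℂ (a * b))).eq_prod_roots_of_monic (minpoly.monic hInteg)
    have hr : (minpoly ℂ (a * b)).roots =
        Multiset.replicate (Multiset.card (minpoly ℂ (a * b)).roots) 0 :=
      Multiset.eq_replicate_card.2 fun x hx => h x (Polynomial.isRoot_of_mem_roots hx)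
    rw [hr] at hp
    have := minpoly.aeval ℂ (a * b)
    rw [hp] at this
    simp at this
    exact nilp_of_pow a b ha hb _ this α β hα hβ
end

section
/- Let A be a finite-dimensional ℂ-algebra and let a, b ∈ A with a² = b² = 0. Then: (i) (1+a, 1+b) is a free pair if and only if there exists an irreducible (finite-dimensional) representation ρ of A such that some eigenvalue of ρ(a·b) is a free point; (ii) the group ⟨1+a, 1+b⟩ is nilpotent if and only if 0 is the only eigenvalue of ρ(a·b) for every irreducible representation ρ of A. -/
/-- `u` and `v` form a free pair. -/
def IsFreePair {G : Type*} [Group G] (u v : G) : Prop :=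
  Function.Injective ((FreeGroup.lift (fun b : Bool => if b then u else v)) : FreeGroup Bool →* G)

/-- `z : ℂ` is a free point. -/
def IsFreePoint (z : ℂ) : Prop :=
  ∀ U V : (Matrix (Fin 2) (Fin 2) ℂ)ˣ,
    (U : Matrix (Fin 2) (Fin 2) ℂ) = !![1, 1; 0, 1] →
    (V : Matrix (Fin 2) (Fin 2) ℂ) = !![1, 0; z, 1] →
    IsFreePair U V

/-- An irreducible (finite-dimensional) representation of a `ℂ`-algebra `A`:
a unital algebra homomorphism `ρ : A → End_ℂ(V)` with `V` a nonzero finite-dimensional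
`ℂ`-vector space which is simple under the induced `A`-action, i.e. the only
`ρ`-invariant subspaces of `V` are `⊥` and `⊤`. -/
structure IrredRep (A : Type) [Ring A] [Algebra ℂ A] where
  V : Type
  [acg : AddCommGroup V]
  [mod : Module ℂ V]
  ρ : A →ₐ[ℂ] Module.End ℂ V
  nontrivial : Nontrivial V
  findim : FiniteDimensional ℂ V
  irred : ∀ W : Submodule ℂ V, (∀ x : A, W ≤ W.comap (ρ x)) → W = ⊥ ∨ W = ⊤

attribute [instance] IrredRep.acg IrredRep.mod

section FreeGroupPart
open Monoid Monoid.CoprodI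

theorem newWord_prod_ne_one {G : Bool → Type*} [∀ i, Group (G i)] {i j : Bool}
    (w : NeWord G i j) : w.prod ≠ 1 := by
  classical
  intro h
  have h1 : w.toWord = Word.empty := by
    apply Word.equiv.symm.injective
    change w.toWord.prod = Word.empty.prod
    rw [Word.prod_empty]; exact h
  exact w.toList_ne_nil (congrArg Word.toList h1)

theorem exists_third (x : FreeGroup Unit) : ∃ h : FreeGroup Unit, h ≠ 1 ∧ h * x ≠ 1 := by
  by_cases hx : FreeGroup.of () * x = 1
  · refine ⟨FreeGroup.of () * FreeGroup.of (), by decide, ?_⟩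
    rw [mul_assoc, hx, mul_one]; exact FreeGroup.of_ne_one _
  · exact ⟨_, FreeGroup.of_ne_one _, hx⟩

theorem conj_newWord (x : CoprodI (fun _ : Bool => FreeGroup Unit)) (hx : x ≠ 1) (k : Bool) :
    ∃ g, ∃ w : NeWord (fun _ : Bool => FreeGroup Unit) k k, w.prod = g * x * g⁻¹ := by
  classical
  have key : ∀ {j} (w : NeWord (fun _ : Bool => FreeGroup Unit) k j), 
      ∃ g, ∃ w' : NeWord (fun _ : Bool => FreeGroup Unit) k k, w'.prod = g * w.prod * g⁻¹ := by
    intro j w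
    by_cases hj : j = k
    · subst hj; exact ⟨1, w, by simp⟩
    · obtain ⟨h, h1, h2⟩ := exists_third w.head
      refine ⟨of (i := k) h, NeWord.append (NeWord.mulHead w h h2) hj
        (NeWord.singleton h⁻¹ (inv_ne_one.mpr h1)), by simp⟩
  have hw : Word.equiv x ≠ Word.empty := by
    intro h; apply hx
    apply Word.equiv.injective
    rw [h]; apply Word.equiv.symm.injective; rw [Equiv.symm_apply_apply]; rfl
  obtain ⟨i, j, w, hw⟩ := NeWord.of_word _ hw
  have hp : w.prod = x := by
    rw [NeWord.prod, hw]; exact Word.equiv.symm_apply_apply x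
  subst hp
  by_cases hi : i = k
  · subst hi; exact key w
  · by_cases hj : j = k
    · subst hj
      obtain ⟨g, w', h'⟩ := key w.inv
      refine ⟨g, w'.inv, ?_⟩
      rw [NeWord.inv_prod, h', NeWord.inv_prod]; group
    · have h1 : (FreeGroup.of () : FreeGroup Unit) ≠ 1 := FreeGroup.of_ne_one _
      refine ⟨of (i := k) (FreeGroup.of ()), NeWord.append (NeWord.append
        (NeWord.singleton (FreeGroup.of ()) h1) (Ne.symm hi) w) hj
        (NeWord.singleton (FreeGroup.of ())⁻¹ (inv_ne_one.mpr h1)), by simp⟩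

theorem free_exists_comm_ne (u v : FreeGroup Bool) (hu : u ≠ 1) (hv : v ≠ 1) :
    ∃ g : FreeGroup Bool, u * (g * v * g⁻¹) * u⁻¹ * (g * v * g⁻¹)⁻¹ ≠ 1 := by
  let e := @freeGroupEquivCoprodI Bool
  obtain ⟨g, w, hw⟩ := conj_newWord (e u) (by simpa using hu) true
  obtain ⟨h, z, hz⟩ := conj_newWord (e v) (by simpa using hv) false
  refine ⟨e.symm (g⁻¹ * h), fun H => ?_⟩
  have H2 := congrArg (fun t => g * e t * g⁻¹) H
  simp only [map_mul, map_inv, MulEquiv.apply_symm_apply] at H2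
  apply newWord_prod_ne_one (NeWord.append (NeWord.append (NeWord.append w (by simp) z)
    (by simp) w.inv) (by simp) z.inv)
  simp only [NeWord.append_prod, NeWord.inv_prod, hw, hz]
  simp only [map_one, mul_one, mul_inv_cancel] at H2
  rw [← H2]; group
end FreeGroupPart

/-- The homomorphism from the free group given by a pair. -/
abbrev pairHom {G : Type*} [Group G] (u v : G) : FreeGroup Bool →* G :=
  FreeGroup.lift (fun b : Bool => if b then u else v)

theorem pair_ind {G H : Type*} [Group G] [Group H] (u v : G) (u' v' : H) (T : G → H → Prop)
    (h1 : T 1 1) (hmul : ∀ g h g' h', T g g' → T h h' → T (g * h) (g' * h'))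
    (hinv : ∀ g g', T g g' → T g⁻¹ g'⁻¹) (hu : T u u') (hv : T v v') (x : FreeGroup Bool) :
    T (pairHom u v x) (pairHom u' v' x) := by
  induction x using FreeGroup.induction_on with
  | C1 => simpa using h1
  | of b => cases b <;> simpa
  | inv_of b ih => rw [map_inv, map_inv]; exact hinv _ _ ih
  | mul x y hx hy => rw [map_mul, map_mul]; exact hmul _ _ _ _ hx hy

theorem mem_closure_pair {G : Type*} [Group G] (u v g : G)
    (hg : g ∈ Subgroup.closure {u, v}) : ∃ x, pairHom u v x = g := by
  have : Subgroup.closure {u, v} ≤ (pairHom u v).range := by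
    rw [Subgroup.closure_le]
    rintro y (rfl | rfl)
    · exact ⟨FreeGroup.of true, by simp⟩
    · exact ⟨FreeGroup.of false, by simp⟩
  exact this hg

theorem fw_ne : (FreeGroup.of true * FreeGroup.of false * (FreeGroup.of true)⁻¹ *
   (FreeGroup.of false)⁻¹) * FreeGroup.of true * (FreeGroup.of true * FreeGroup.of false * (FreeGroup.of true)⁻¹ *
   (FreeGroup.of false)⁻¹)⁻¹ * (FreeGroup.of true)⁻¹ ≠ (1 : FreeGroup Bool) := by decide
section RepPart
variable {A : Type} [Ring A] [Algebra ℂ A]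

theorem eig_data {V : Type} [AddCommGroup V] [Module ℂ V] (ρ : A →ₐ[ℂ] Module.End ℂ V)
    (a b : A) (ha : a ^ 2 = 0) (hb : b ^ 2 = 0) (lam : ℂ) (h0 : lam ≠ 0)
    (h : (ρ (a * b)).HasEigenvalue lam) :
    ∃ v w : V, (∀ x y : ℂ, x • v + y • w = 0 → x = 0 ∧ y = 0) ∧ ρ a v = 0 ∧ ρ a w = v ∧
      ρ b v = lam • w ∧ ρ b w = 0 := by
  obtain ⟨e, he⟩ := h.exists_hasEigenvector
  have he1 : ρ a (ρ b e) = lam • e := by simpa using he.apply_eq_smul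
  have haa : ∀ x, ρ a (ρ a x) = 0 := fun x => by
    rw [← Module.End.mul_apply, ← map_mul, ← sq, ha]; simp
  have hbb : ∀ x, ρ b (ρ b x) = 0 := fun x => by
    rw [← Module.End.mul_apply, ← map_mul, ← sq, hb]; simp
  have hne : lam • e ≠ 0 := smul_ne_zero h0 he.2
  have hav : ρ a (lam • e) = 0 := by rw [← he1, haa]
  refine ⟨lam • e, ρ b e, ?_, hav, he1, by simp, hbb _⟩
  intro x y hxy
  have h1 := congrArg (ρ a) hxy
  rw [map_add, map_smul, hav, map_smul, he1, map_zero, smul_zero, zero_add] at h1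
  have hy : y = 0 := (smul_eq_zero.mp h1).resolve_right hne
  subst hy
  rw [zero_smul, add_zero] at hxy
  exact ⟨(smul_eq_zero.mp hxy).resolve_right hne, rfl⟩

/-- The unit `U`. -/
def matU : (Matrix (Fin 2) (Fin 2) ℂ)ˣ :=
  ⟨!![1, 1; 0, 1], !![1, -1; 0, 1], by ext i j; fin_cases i <;> fin_cases j <;> simp,
    by ext i j; fin_cases i <;> fin_cases j <;> simp⟩

/-- The unit `V`. -/
def matV (z : ℂ) : (Matrix (Fin 2) (Fin 2) ℂ)ˣ :=
  ⟨!![1, 0; z, 1], !![1, 0; -z, 1], by ext i j; fin_cases i <;> fin_cases j <;> simp,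
    by ext i j; fin_cases i <;> fin_cases j <;> simp⟩

theorem free_point_iff (z : ℂ) : IsFreePoint z ↔ IsFreePair matU (matV z) := by
  constructor
  · intro h; exact h _ _ rfl rfl
  · intro h U V hU hV
    have h1 : U = matU := Units.ext hU
    have h2 : V = matV z := Units.ext hV
    rw [h1, h2]; exact h

theorem not_free_zero : ¬ IsFreePoint 0 := by
  rw [free_point_iff]
  intro h
  have : FreeGroup.of false = 1 := by
    apply h
    have : matV 0 = 1 := Units.ext (by simp [matV, Matrix.one_fin_two])
    simp [this]
  exact FreeGroup.of_ne_one _ this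

theorem rep_word {V : Type} [AddCommGroup V] [Module ℂ V] (ρ : A →ₐ[ℂ] Module.End ℂ V)
    (a b : A) (α β : Aˣ) (hα : (α : A) = 1 + a) (hβ : (β : A) = 1 + b) (lam : ℂ)
    (v w : V) (h1 : ρ a v = 0) (h2 : ρ a w = v) (h3 : ρ b v = lam • w) (h4 : ρ b w = 0)
    (x : FreeGroup Bool) (c : Fin 2 → ℂ) :
    ρ (pairHom α β x : Aˣ) (c 0 • v + c 1 • w) =
      ((pairHom matU (matV lam) x : Matrix (Fin 2) (Fin 2) ℂ).mulVec c) 0 • v +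
      ((pairHom matU (matV lam) x : Matrix (Fin 2) (Fin 2) ℂ).mulVec c) 1 • w := by
  revert c
  refine pair_ind α β matU (matV lam) (fun g M => ∀ c : Fin 2 → ℂ,
    ρ (g : A) (c 0 • v + c 1 • w) = ((M : Matrix (Fin 2) (Fin 2) ℂ).mulVec c) 0 • v +
      ((M : Matrix (Fin 2) (Fin 2) ℂ).mulVec c) 1 • w) ?_ ?_ ?_ ?_ ?_ x
  · intro c; simp
  · intro g h M N hg hh c
    rw [Units.val_mul, map_mul, Module.End.mul_apply, hh, hg, Matrix.mulVec_mulVec, Units.val_mul]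
  · intro g M hg c
    have h := hg (((M⁻¹ : (Matrix (Fin 2) (Fin 2) ℂ)ˣ) : Matrix (Fin 2) (Fin 2) ℂ).mulVec c)
    rw [Matrix.mulVec_mulVec, Units.mul_inv, Matrix.one_mulVec] at h
    rw [← h, ← Module.End.mul_apply, ← map_mul, Units.inv_mul]; simp
  · intro c
    simp [hα, matU, h1, h2, Matrix.mulVec, dotProduct]
    module
  · intro c
    simp [hβ, matV, h3, h4, Matrix.mulVec, dotProduct]
    module

theorem free_of_eig {V : Type} [AddCommGroup V] [Module ℂ V] (ρ : A →ₐ[ℂ] Module.End ℂ V)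
    (a b : A) (ha : a ^ 2 = 0) (hb : b ^ 2 = 0)
    (α β : Aˣ) (hα : (α : A) = 1 + a) (hβ : (β : A) = 1 + b) (lam : ℂ)
    (h : (ρ (a * b)).HasEigenvalue lam) (hf : IsFreePoint lam) : IsFreePair α β := by
  have h0 : lam ≠ 0 := by rintro rfl; exact not_free_zero hf
  obtain ⟨v, w, hi, h1, h2, h3, h4⟩ := eig_data ρ a b ha hb lam h0 h
  rw [free_point_iff] at hf
  refine (injective_iff_map_eq_one (pairHom α β)).2 fun x hx => ?_
  refine (injective_iff_map_eq_one (pairHom matU (matV lam))).1 hf x ?_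
  have H := rep_word ρ a b α β hα hβ lam v w h1 h2 h3 h4 x
  rw [hx] at H
  set M := pairHom matU (matV lam) x
  have H' : ∀ c : Fin 2 → ℂ, (M : Matrix (Fin 2) (Fin 2) ℂ).mulVec c = c := by
    intro c
    have H2 := H c
    simp only [Units.val_one, map_one, Module.End.one_apply] at H2
    have := hi (c 0 - (M : Matrix (Fin 2) (Fin 2) ℂ).mulVec c 0)
      (c 1 - (M : Matrix (Fin 2) (Fin 2) ℂ).mulVec c 1) (by
        rw [sub_smul, sub_smul, sub_add_sub_comm, H2, sub_self])
    ext i; fin_cases i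
    · exact (sub_eq_zero.mp this.1).symm
    · exact (sub_eq_zero.mp this.2).symm
  ext1
  rw [Units.val_one]
  exact Matrix.ext_of_mulVec_single (fun i => by rw [H', Matrix.one_mulVec])

theorem eig_zero_of_nilpotent {V : Type} [AddCommGroup V] [Module ℂ V]
    (ρ : A →ₐ[ℂ] Module.End ℂ V)
    (a b : A) (ha : a ^ 2 = 0) (hb : b ^ 2 = 0)
    (α β : Aˣ) (hα : (α : A) = 1 + a) (hβ : (β : A) = 1 + b) (lam : ℂ)
    (h : (ρ (a * b)).HasEigenvalue lam)
    (hn : Group.IsNilpotent ↥(Subgroup.closure {α, β})) : lam = 0 := by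
  by_contra h0
  obtain ⟨v, w, hi, h1, h2, h3, h4⟩ := eig_data ρ a b ha hb lam h0 h
  have hinj : ∀ p q p' q' : ℂ, p • v + q • w = p' • v + q' • w → p = p' ∧ q = q' := by
    intro p q p' q' e
    have := hi (p - p') (q - q') (by rw [sub_smul, sub_smul, sub_add_sub_comm, e, sub_self])
    exact ⟨sub_eq_zero.mp this.1, sub_eq_zero.mp this.2⟩
  have αv : ρ α v = v := by simp [hα, h1]
  have αw : ρ α w = w + v := by simp [hα, h2]
  have βv : ρ β v = v + lam • w := by simp [hβ, h3]
  have βw : ρ β w = w := by simp [hβ, h4]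
  have key : ∀ n, ∀ g ∈ Subgroup.upperCentralSeries ↥(Subgroup.closure {α, β}) n,
      ∃ c : ℂ, ρ (g : Aˣ) v = c • v ∧ ρ (g : Aˣ) w = c • w := by
    intro n
    induction n with
    | zero =>
      intro g hg
      have : g = 1 := by simpa using hg
      subst this
      exact ⟨1, by simp, by simp⟩
    | succ n ih =>
      intro g hg
      rw [Subgroup.mem_upperCentralSeries_succ_iff] at hg
      obtain ⟨c, hc1, hc2⟩ := ih _ (hg ⟨α, Subgroup.subset_closure (by simp)⟩)
      obtain ⟨d, hd1, hd2⟩ := ih _ (hg ⟨β, Subgroup.subset_closure (by simp)⟩)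
      obtain ⟨g, hgm⟩ := g
      obtain ⟨x, hx⟩ := mem_closure_pair α β g hgm
      have H := rep_word ρ a b α β hα hβ lam v w h1 h2 h3 h4 x
      rw [hx] at H
      set M := (pairHom matU (matV lam) x : Matrix (Fin 2) (Fin 2) ℂ)
      have gv : ρ (g : A) v = M 0 0 • v + M 1 0 • w := by
        simpa [Matrix.mulVec, dotProduct] using H ![1, 0]
      have gw : ρ (g : A) w = M 0 1 • v + M 1 1 • w := by
        simpa [Matrix.mulVec, dotProduct] using H ![0, 1]
      have ginj : ∀ y, ρ (g : A) y = 0 → y = 0 := by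
        intro y hy
        have := congrArg (ρ ((g⁻¹ : Aˣ) : A)) hy
        rwa [← Module.End.mul_apply, ← map_mul, Units.inv_mul, map_one, map_zero] at this
      generalize M 0 0 = p at *
      generalize M 0 1 = q at *
      generalize M 1 0 = r at *
      generalize M 1 1 = t at *
      have eα : ∀ y, ρ (g : A) (ρ (α : A) y) = ρ ((g * α * g⁻¹ * α⁻¹ : Aˣ) : A) (ρ (α : A) (ρ (g : A) y)) := by
        intro y
        simp only [← Module.End.mul_apply, ← map_mul, ← Units.val_mul]
        congr 3; group
      have eβ : ∀ y, ρ (g : A) (ρ (β : A) y) = ρ ((g * β * g⁻¹ * β⁻¹ : Aˣ) : A) (ρ (β : A) (ρ (g : A) y)) := by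
        intro y
        simp only [← Module.End.mul_apply, ← map_mul, ← Units.val_mul]
        congr 3; group
      have hc1' : ρ ((g * α * g⁻¹ * α⁻¹ : Aˣ) : A) v = c • v := hc1
      have hc2' : ρ ((g * α * g⁻¹ * α⁻¹ : Aˣ) : A) w = c • w := hc2
      have hd1' : ρ ((g * β * g⁻¹ * β⁻¹ : Aˣ) : A) v = d • v := hd1
      have hd2' : ρ ((g * β * g⁻¹ * β⁻¹ : Aˣ) : A) w = d • w := hd2
      have E1 := eα v
      have E2 := eα w
      have E3 := eβ v
      have E4 := eβ w
      simp only [αv, αw, βv, βw, gv, gw, map_add, map_smul, hc1', hc2', hd1', hd2'] at E1 E2 E3 E4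
      have F1 := hinj p r (c * (p + r)) (c * r) (by rw [E1]; module)
      have F2 := hinj (q + p) (t + r) (c * (q + t)) (c * t)
        (by rw [show (q + p) • v + (t + r) • w = q • v + t • w + (p • v + r • w) by module, E2]
            module)
      have F4 := hinj q t (d * q) (d * (t + lam * q)) (by rw [E4]; module)
      have hr : r = 0 := by
        by_contra hr
        have hc : c = 1 := by
          have : (c - 1) * r = 0 := by linear_combination -F1.2
          rcases mul_eq_zero.mp this with h | h
          · exact sub_eq_zero.mp h
          · exact absurd h hr
        apply hr; have := F1.1; rw [hc] at this; linear_combination -this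
      have hq : q = 0 := by
        by_contra hq
        have hc : d = 1 := by
          have : (d - 1) * q = 0 := by linear_combination -F4.1
          rcases mul_eq_zero.mp this with h | h
          · exact sub_eq_zero.mp h
          · exact absurd h hq
        have := F4.2; rw [hc] at this
        have h5 : lam * q = 0 := by linear_combination -this
        rcases mul_eq_zero.mp h5 with h | h
        · exact h0 h
        · exact hq h
      subst hr hq
      have hp : p ≠ 0 := by
        rintro rfl
        have := ginj v (by rw [gv]; simp)
        have := hi 1 0 (by simp [this])
        exact one_ne_zero this.1
      have hc : c = 1 := by
        have : (c - 1) * p = 0 := by linear_combination -F1.1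
        rcases mul_eq_zero.mp this with h | h
        · exact sub_eq_zero.mp h
        · exact absurd h hp
      have hpt : p = t := by have := F2.1; rw [hc] at this; linear_combination this
      subst hpt
      exact ⟨p, by simp [gv], by simp [gw]⟩
  obtain ⟨n, hn⟩ := hn.nilpotent
  obtain ⟨c, hc1, hc2⟩ := key n ⟨α, Subgroup.subset_closure (by simp)⟩ (by rw [hn]; trivial)
  have := hinj 1 1 0 c (by
    rw [one_smul, one_smul, add_comm, ← αw, zero_smul, zero_add]; exact hc2)
  exact one_ne_zero this.1
end RepPart
section AlgPart
variable {A : Type} [Ring A] [Algebra ℂ A]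

theorem exists_irrep [FiniteDimensional ℂ A] (a b : A) (ha : a ^ 2 = 0) (hb : b ^ 2 = 0)
    (lam : ℂ) (h0 : lam ≠ 0) (hr : (minpoly ℂ (a * b + b * a)).IsRoot lam) :
    ∃ R : IrredRep A, (R.ρ (a * b)).HasEigenvalue lam := by
  set s := a * b + b * a with hs
  have hint : IsIntegral ℂ s := IsIntegral.of_finite ℂ s
  obtain ⟨q, hq⟩ := Polynomial.dvd_iff_isRoot.mpr hr
  have hq0 : Polynomial.aeval s q ≠ 0 := by
    intro h
    have hqne : q ≠ 0 := by
      rintro rfl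
      exact minpoly.ne_zero hint (by rw [hq, mul_zero])
    have h1 := minpoly.degree_le_of_ne_zero ℂ s hqne h
    rw [hq, Polynomial.degree_mul, Polynomial.degree_X_sub_C,
      Polynomial.degree_eq_natDegree hqne] at h1
    norm_cast at h1
    omega
  have hz : (s - algebraMap ℂ A lam) * Polynomial.aeval s q = 0 := by
    have := minpoly.aeval ℂ s
    rw [hq, map_mul] at this
    simpa using this
  have hproper : Ideal.span {s - algebraMap ℂ A lam} ≠ ⊤ := by
    intro h
    rw [Ideal.eq_top_iff_one, Ideal.mem_span_singleton'] at h
    obtain ⟨y, hy⟩ := h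
    apply hq0
    rw [← one_mul (Polynomial.aeval s q), ← hy, mul_assoc, hz, mul_zero]
  obtain ⟨M, hM, hle⟩ := Ideal.exists_le_maximal _ hproper
  let ρ : A →ₐ[ℂ] Module.End ℂ (A ⧸ M) := Algebra.lsmul ℂ ℂ (A ⧸ M)
  have hsimp : IsSimpleModule A (A ⧸ M) := isSimpleModule_iff_isCoatom.mpr hM.out
  have hnt : Nontrivial (A ⧸ M) := hsimp.nontrivial
  let R : IrredRep A :=
    { V := A ⧸ M
      ρ := ρ
      nontrivial := hnt
      findim := by
        exact Module.Finite.of_surjective (M.mkQ.restrictScalars ℂ) M.mkQ_surjective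
      irred := by
        intro W hW
        let W' : Submodule A (A ⧸ M) :=
          { W with smul_mem' := fun c x hx => hW c hx }
        rcases eq_bot_or_eq_top W' with h | h
        · left
          rw [eq_bot_iff]; intro x hx
          have : x ∈ W' := hx
          rw [h] at this; exact this
        · right
          rw [eq_top_iff]; intro x hx
          have : x ∈ W' := by rw [h]; trivial
          exact this }
  refine ⟨R, ?_⟩
  change (ρ (a * b)).HasEigenvalue lam
  let v : A ⧸ M := M.mkQ 1
  have hv0 : v ≠ 0 := by
    intro h
    have : (1 : A) ∈ M := (Submodule.Quotient.mk_eq_zero M).mp h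
    exact hM.ne_top ((Ideal.eq_top_iff_one _).mpr this)
  have hv : ρ a (ρ b v) + ρ b (ρ a v) = lam • v := by
    have h1 : (s - algebraMap ℂ A lam) ∈ M := hle (Ideal.mem_span_singleton_self _)
    have h2 : ρ (s - algebraMap ℂ A lam) v = 0 := by
      change (s - algebraMap ℂ A lam) • M.mkQ 1 = 0
      rw [← map_smul, smul_eq_mul, mul_one]
      exact (Submodule.Quotient.mk_eq_zero M).mpr h1
    rw [map_sub, hs, map_add, map_mul, map_mul, AlgHom.commutes] at h2
    simpa [sub_eq_zero, Module.algebraMap_end_apply] using h2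
  have haa : ∀ x, ρ a (ρ a x) = 0 := fun x => by
    rw [← Module.End.mul_apply, ← map_mul, ← sq, ha]; simp
  have hbb : ∀ x, ρ b (ρ b x) = 0 := fun x => by
    rw [← Module.End.mul_apply, ← map_mul, ← sq, hb]; simp
  have mk : ∀ e, e ≠ 0 → ρ a (ρ b e) = lam • e → (ρ (a * b)).HasEigenvalue lam := by
    intro e he h
    refine Module.End.hasEigenvalue_of_hasEigenvector (x := e) ⟨?_, he⟩
    rw [Module.End.mem_eigenspace_iff, map_mul]; exact h
  by_cases hab : ρ a (ρ b v) = 0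
  · rw [hab, zero_add] at hv
    refine mk (ρ a v) ?_ ?_
    · intro h; rw [h, map_zero] at hv
      exact smul_ne_zero h0 hv0 hv.symm
    · rw [hv, map_smul]
  · refine mk _ hab ?_
    have := congrArg (fun x => ρ a (ρ b x)) hv
    simpa [hbb] using this

theorem comm_sa (a b : A) (ha : a ^ 2 = 0) : Commute (a * b + b * a) a := by
  rw [sq] at ha
  change _ = _
  rw [add_mul, mul_add, mul_assoc b, ha, ← mul_assoc a a, ha, mul_assoc]; simp

theorem comm_sb (a b : A) (hb : b ^ 2 = 0) : Commute (a * b + b * a) b := by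
  rw [add_comm]; exact comm_sa b a hb

theorem comm_word (s : A) (α β : Aˣ) (h1 : Commute s α) (h2 : Commute s β) (x : FreeGroup Bool) :
    Commute s (pairHom α β x : Aˣ) := by
  refine pair_ind α β α β (fun g _ => Commute s (g : A)) ?_ ?_ ?_ h1 h2 x
  · simp
  · intro g h _ _ hg hh; rw [Units.val_mul]; exact hg.mul_right hh
  · intro g _ hg; exact hg.units_inv_right

theorem comm_aeval (s y : A) (h : Commute s y) (p : Polynomial ℂ) :
    Commute (Polynomial.aeval s p) y := by
  induction p using Polynomial.induction_on' with
  | add p q hp hq => rw [map_add]; exact hp.add_left hq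
  | monomial n c =>
    rw [Polynomial.aeval_monomial]
    exact Commute.mul_left (Algebra.commutes c y) (h.pow_left n)

/-- `x` is a multiple of `p(s)` by an element commuting with `s`. -/
def Kill (s : A) (p : Polynomial ℂ) (x : A) : Prop :=
  ∃ y, Commute s y ∧ x = Polynomial.aeval s p * y

theorem kill_comm (s : A) (p q : Polynomial ℂ) (g h : Aˣ) (hg : Commute s g) (hh : Commute s h)
    (h1 : Kill s p (g - 1)) (h2 : Kill s q (h - 1)) :
    Kill s (p * q) (((g * h * g⁻¹ * h⁻¹ : Aˣ) : A) - 1) := by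
  obtain ⟨y, hy, e1⟩ := h1
  obtain ⟨z, hz, e2⟩ := h2
  refine ⟨(y * z - z * y) * (g⁻¹ : Aˣ) * (h⁻¹ : Aˣ), ?_, ?_⟩
  · exact (((hy.mul_right hz).sub_right (hz.mul_right hy)).mul_right
      hg.units_inv_right).mul_right hh.units_inv_right
  · have e : ((g * h * g⁻¹ * h⁻¹ : Aˣ) : A) - 1 =
        (((g : A) - 1) * (h - 1) - (h - 1) * (g - 1)) * ((g⁻¹ : Aˣ) * (h⁻¹ : Aˣ)) := by
      have : ((g : A) - 1) * (h - 1) - (h - 1) * (g - 1) = g * h - h * g := by noncomm_ring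
      rw [this, sub_mul, mul_assoc (h : A), Units.mul_inv_cancel_left, Units.mul_inv]
      simp [mul_assoc]
    rw [e, e1, e2, map_mul]
    have c1 : Polynomial.aeval s p * y * (Polynomial.aeval s q * z) =
      Polynomial.aeval s p * Polynomial.aeval s q * (y * z) := by
      rw [mul_assoc, ← mul_assoc y, ← (comm_aeval s y hy q).eq]; simp only [mul_assoc]
    have c2 : Polynomial.aeval s q * z * (Polynomial.aeval s p * y) =
      Polynomial.aeval s p * Polynomial.aeval s q * (z * y) := by
      rw [mul_assoc, ← mul_assoc z, ← (comm_aeval s z hz p).eq, ← map_mul, mul_comm p q, map_mul]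
      simp only [mul_assoc]
    rw [c1, c2, ← mul_sub]; simp only [mul_assoc]

theorem kill_conj (s : A) (q : Polynomial ℂ) (g h : Aˣ) (hg : Commute s g)
    (h2 : Kill s q (h - 1)) : Kill s q (((g * h * g⁻¹ : Aˣ) : A) - 1) := by
  obtain ⟨z, hz, e2⟩ := h2
  refine ⟨g * z * (g⁻¹ : Aˣ), (hg.mul_right hz).mul_right hg.units_inv_right, ?_⟩
  rw [← mul_assoc, ← mul_assoc, (comm_aeval s g hg q).eq, mul_assoc (g : A), ← e2]
  rw [mul_sub, sub_mul, mul_one, Units.mul_inv]; simp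

/-- The map from matrices. -/
def phi (a b : A) (μ : ℂ) (N : Matrix (Fin 2) (Fin 2) ℂ) : A :=
  (μ * N 0 0) • (a * b) + N 0 1 • a + (μ * N 1 0) • b + (μ * N 1 1) • (b * a)

theorem kill_nonfree (a b : A) (ha : a ^ 2 = 0) (hb : b ^ 2 = 0)
    (α β : Aˣ) (hα : (α : A) = 1 + a) (hβ : (β : A) = 1 + b) (lam : ℂ) (h0 : lam ≠ 0)
    (x : FreeGroup Bool) (hx : pairHom matU (matV lam) x = 1) :
    Kill (a * b + b * a) (Polynomial.X - Polynomial.C lam) ((pairHom α β x : Aˣ) - 1) := by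
  have csa := comm_sa a b ha
  have csb := comm_sb a b hb
  rw [sq] at ha hb
  have haa : ∀ y, a * (a * y) = 0 := fun y => by rw [← mul_assoc, ha, zero_mul]
  have hbb : ∀ y, b * (b * y) = 0 := fun y => by rw [← mul_assoc, hb, zero_mul]
  have hαs : Commute (a * b + b * a) (α : A) := by rw [hα]; exact (Commute.one_right _).add_right csa
  have hβs : Commute (a * b + b * a) (β : A) := by rw [hβ]; exact (Commute.one_right _).add_right csb
  obtain ⟨μ, hμ⟩ : ∃ μ : ℂ, μ * lam = 1 := ⟨lam⁻¹, inv_mul_cancel₀ h0⟩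
  have key : ∀ N : Matrix (Fin 2) (Fin 2) ℂ, ∃ y, Commute (a * b + b * a) y ∧
      ((pairHom α β x : Aˣ) : A) * phi a b μ N -
       phi a b μ ((pairHom matU (matV lam) x : Matrix (Fin 2) (Fin 2) ℂ) * N) =
      ((a * b + b * a) - algebraMap ℂ A lam) * y := by
    refine (pair_ind α β matU (matV lam) (fun g M => Commute (a * b + b * a) (g : A) ∧
      ∀ N : Matrix (Fin 2) (Fin 2) ℂ, ∃ y, Commute (a * b + b * a) y ∧
      (g : A) * phi a b μ N - phi a b μ ((M : Matrix (Fin 2) (Fin 2) ℂ) * N) =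
      ((a * b + b * a) - algebraMap ℂ A lam) * y) ?_ ?_ ?_ ?_ ?_ x).2
    · exact ⟨by simp, fun N => ⟨0, by simp, by simp⟩⟩
    · rintro g h M M' ⟨hg, Hg⟩ ⟨hh, Hh⟩
      refine ⟨by rw [Units.val_mul]; exact hg.mul_right hh, fun N => ?_⟩
      obtain ⟨y, hy, e1⟩ := Hh N
      obtain ⟨z, hz, e2⟩ := Hg (M' * N)
      refine ⟨g * y + z, (hg.mul_right hy).add_right hz, ?_⟩
      have hc : Commute (a * b + b * a - algebraMap ℂ A lam) (g : A) :=
        hg.sub_left (Algebra.commutes _ _)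
      rw [mul_add, ← mul_assoc, hc.eq, mul_assoc, ← e1, ← e2, Units.val_mul, Units.val_mul]
      rw [Matrix.mul_assoc]
      noncomm_ring
    · rintro g M ⟨hg, Hg⟩
      refine ⟨hg.units_inv_right, fun N => ?_⟩
      obtain ⟨y, hy, e1⟩ := Hg ((M⁻¹ : (Matrix (Fin 2) (Fin 2) ℂ)ˣ) * N)
      refine ⟨-((g⁻¹ : Aˣ) * y), (hg.units_inv_right.mul_right hy).neg_right, ?_⟩
      have hc : Commute (a * b + b * a - algebraMap ℂ A lam) ((g⁻¹ : Aˣ) : A) :=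
        hg.units_inv_right.sub_left (Algebra.commutes _ _)
      rw [mul_neg, ← mul_assoc, hc.eq, mul_assoc, ← e1, ← Matrix.mul_assoc, Units.mul_inv,
        Matrix.one_mul, mul_sub, Units.inv_mul_cancel_left, neg_sub]
    · refine ⟨hαs, fun N => ⟨(μ * N 1 1) • a, csa.smul_right _, ?_⟩⟩
      simp only [hα, phi, matU, Matrix.mul_apply, Fin.sum_univ_two, Matrix.of_apply,
        Matrix.cons_val_zero, Matrix.cons_val_one, Matrix.cons_val', Matrix.cons_val_fin_one]
      simp only [add_mul, sub_mul, mul_add, one_mul, mul_smul_comm, smul_mul_assoc, mul_assoc,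
        ha, haa, Algebra.algebraMap_eq_smul_one, mul_zero, add_zero]
      linear_combination (norm := module) hμ • (N 1 1 • a)
    · refine ⟨hβs, fun N => ⟨(μ * N 0 0) • b, csb.smul_right _, ?_⟩⟩
      simp only [hβ, phi, matV, Matrix.mul_apply, Fin.sum_univ_two, Matrix.of_apply,
        Matrix.cons_val_zero, Matrix.cons_val_one, Matrix.cons_val', Matrix.cons_val_fin_one]
      simp only [add_mul, sub_mul, mul_add, one_mul, mul_smul_comm, smul_mul_assoc, mul_assoc,
        hb, hbb, Algebra.algebraMap_eq_smul_one, mul_zero, add_zero]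
      linear_combination (norm := module) (-hμ) • (N 0 1 • (b * a))
  obtain ⟨y, hy, e⟩ := key 1
  have cg := comm_word _ α β hαs hβs x
  set g := ((pairHom α β x : Aˣ) : A)
  refine ⟨y - μ • (g - 1), hy.sub_right ((cg.sub_right (Commute.one_right _)).smul_right _), ?_⟩
  have hphi : phi a b μ 1 = μ • (a * b + b * a) := by
    simp [phi, smul_add]
  rw [hx, Units.val_one, mul_one, hphi] at e
  rw [map_sub, Polynomial.aeval_X, Polynomial.aeval_C, mul_sub, ← e]
  have cg1 : Commute (a * b + b * a) (g - 1) := cg.sub_right (Commute.one_right _)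
  have e5 : (a * b + b * a) * (μ • (g - 1)) = μ • (g * (a * b + b * a) - (a * b + b * a)) := by
    rw [mul_smul_comm, cg1.eq, sub_mul, one_mul]
  rw [sub_mul (a * b + b * a), e5, Algebra.algebraMap_eq_smul_one, smul_mul_assoc, one_mul,
    mul_smul_comm]
  linear_combination (norm := module) (-hμ) • (g - 1)

theorem kill_zero (a b : A) (ha : a ^ 2 = 0) (hb : b ^ 2 = 0)
    (α β : Aˣ) (hα : (α : A) = 1 + a) (hβ : (β : A) = 1 + b) :
    Kill (a * b + b * a) Polynomial.X
      (((α * β * α⁻¹ * β⁻¹) * α * (α * β * α⁻¹ * β⁻¹)⁻¹ * α⁻¹ : Aˣ) - 1) := by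
  have csa := comm_sa a b ha
  have csb := comm_sb a b hb
  rw [sq] at ha hb
  have haa : ∀ y, a * (a * y) = 0 := fun y => by rw [← mul_assoc, ha, zero_mul]
  have hbb : ∀ y, b * (b * y) = 0 := fun y => by rw [← mul_assoc, hb, zero_mul]
  have hαs : Commute (a * b + b * a) (α : A) := by rw [hα]; exact (Commute.one_right _).add_right csa
  have hβs : Commute (a * b + b * a) (β : A) := by rw [hβ]; exact (Commute.one_right _).add_right csb
  have hα' : ((α⁻¹ : Aˣ) : A) = 1 - a := by
    apply Units.inv_eq_of_mul_eq_one_right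
    rw [hα]; simp [add_mul, mul_sub, ha]
  have hβ' : ((β⁻¹ : Aˣ) : A) = 1 - b := by
    apply Units.inv_eq_of_mul_eq_one_right
    rw [hβ]; simp [add_mul, mul_sub, hb]
  have hcs : Commute (a * b + b * a) ((α * β * α⁻¹ * β⁻¹ : Aˣ) : A) := by
    simp only [Units.val_mul]
    exact ((hαs.mul_right hβs).mul_right hαs.units_inv_right).mul_right hβs.units_inv_right
  have hc : ((α * β * α⁻¹ * β⁻¹ : Aˣ) : A) * α - α * (α * β * α⁻¹ * β⁻¹ : Aˣ) =
      (a * b + b * a) * (a + a + (b * a + a * b * a - a * b)) := by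
    simp only [Units.val_mul, hα, hβ, hα', hβ']
    simp only [add_mul, sub_mul, mul_add, mul_sub, one_mul, mul_one, mul_assoc,
        ha, haa, hb, hbb, mul_zero, add_zero, zero_add, sub_zero]
    abel
  generalize α * β * α⁻¹ * β⁻¹ = c at *
  refine ⟨(a + a + (b * a + a * b * a - a * b)) * (c⁻¹ : Aˣ) * (α⁻¹ : Aˣ), ?_, ?_⟩
  · refine Commute.mul_right (Commute.mul_right ?_ hcs.units_inv_right) hαs.units_inv_right
    exact (csa.add_right csa).add_right (((csb.mul_right csa).add_right
      ((csa.mul_right csb).mul_right csa)).sub_right (csa.mul_right csb))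
  · rw [Polynomial.aeval_X, ← mul_assoc, ← mul_assoc, ← hc, sub_mul, sub_mul,
      Units.mul_inv_cancel_right, Units.mul_inv]
    simp only [Units.val_mul]

theorem not_free_of_roots [FiniteDimensional ℂ A] (a b : A) (ha : a ^ 2 = 0) (hb : b ^ 2 = 0)
    (α β : Aˣ) (hα : (α : A) = 1 + a) (hβ : (β : A) = 1 + b)
    (h : ∀ lam : ℂ, lam ≠ 0 → (minpoly ℂ (a * b + b * a)).IsRoot lam → ¬ IsFreePoint lam) :
    ¬ IsFreePair α β := by
  intro hf
  have csa := comm_sa a b ha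
  have csb := comm_sb a b hb
  have hαs : Commute (a * b + b * a) (α : A) := by rw [hα]; exact (Commute.one_right _).add_right csa
  have hβs : Commute (a * b + b * a) (β : A) := by rw [hβ]; exact (Commute.one_right _).add_right csb
  have hint : IsIntegral ℂ (a * b + b * a) := IsIntegral.of_finite ℂ _
  have hroot : ∀ lam ∈ (minpoly ℂ (a * b + b * a)).roots, ∃ x : FreeGroup Bool, x ≠ 1 ∧
      Kill (a * b + b * a) (Polynomial.X - Polynomial.C lam) ((pairHom α β x : Aˣ) - 1) := by
    intro lam hl
    by_cases h0 : lam = 0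
    · subst h0
      refine ⟨_, fw_ne, ?_⟩
      have := kill_zero a b ha hb α β hα hβ
      simpa using this
    · have := h lam h0 (Polynomial.isRoot_of_mem_roots hl)
      rw [free_point_iff] at this
      unfold IsFreePair at this
      rw [injective_iff_map_eq_one] at this
      push Not at this
      obtain ⟨x, hx, hx1⟩ := this
      exact ⟨x, hx1, kill_nonfree a b ha hb α β hα hβ lam h0 x hx⟩
  have hprod : ∀ S : Multiset ℂ, (∀ lam ∈ S, ∃ x : FreeGroup Bool, x ≠ 1 ∧
      Kill (a * b + b * a) (Polynomial.X - Polynomial.C lam) ((pairHom α β x : Aˣ) - 1)) →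
      ∃ x : FreeGroup Bool, x ≠ 1 ∧ Kill (a * b + b * a)
        (S.map (fun r => Polynomial.X - Polynomial.C r)).prod ((pairHom α β x : Aˣ) - 1) := by
    intro S
    induction S using Multiset.induction with
    | empty =>
      intro _
      refine ⟨FreeGroup.of true, FreeGroup.of_ne_one _, a, csa, ?_⟩
      simp [hα]
    | cons r S ih =>
      intro hS
      obtain ⟨u, hu, ku⟩ := hS r (by simp)
      obtain ⟨v, hv, kv⟩ := ih (fun l hl => hS l (Multiset.mem_cons_of_mem hl))
      obtain ⟨g, hg⟩ := free_exists_comm_ne u v hu hv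
      refine ⟨_, hg, ?_⟩
      have cw := comm_word _ α β hαs hβs
      have k2 := kill_conj _ _ (pairHom α β g) (pairHom α β v) (cw g) kv
      rw [← map_inv, ← map_mul, ← map_mul] at k2
      have k3 := kill_comm _ _ _ _ _ (cw u) (cw _) ku k2
      rw [Multiset.map_cons, Multiset.prod_cons]
      simpa only [← map_inv, ← map_mul] using k3
  obtain ⟨x, hx, y, hy, e⟩ := hprod _ hroot
  rw [← (IsAlgClosed.splits (minpoly ℂ (a * b + b * a))).eq_prod_roots_of_monic
    (minpoly.monic hint), minpoly.aeval, zero_mul, sub_eq_zero] at e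
  apply hx
  apply hf
  rw [map_one]
  exact Units.ext e

theorem nilpotent_of_s (a b : A) (ha : a ^ 2 = 0) (hb : b ^ 2 = 0)
    (α β : Aˣ) (hα : (α : A) = 1 + a) (hβ : (β : A) = 1 + b) (k : ℕ)
    (hk : (a * b + b * a) ^ k = 0) :
    Group.IsNilpotent ↥(Subgroup.closure {α, β}) := by
  have csa := comm_sa a b ha
  have csb := comm_sb a b hb
  rw [sq] at ha hb
  have haa : ∀ y, a * (a * y) = 0 := fun y => by rw [← mul_assoc, ha, zero_mul]
  have hbb : ∀ y, b * (b * y) = 0 := fun y => by rw [← mul_assoc, hb, zero_mul]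
  have hα' : ((α⁻¹ : Aˣ) : A) = 1 - a := by
    apply Units.inv_eq_of_mul_eq_one_right
    rw [hα]; simp [add_mul, mul_sub, ha]
  have hβ' : ((β⁻¹ : Aˣ) : A) = 1 - b := by
    apply Units.inv_eq_of_mul_eq_one_right
    rw [hβ]; simp [add_mul, mul_sub, hb]
  let M : Submodule ℂ A := Submodule.span ℂ {a, b}
  have haM : a ∈ M := Submodule.subset_span (by simp)
  have hbM : b ∈ M := Submodule.subset_span (by simp)
  let S : Submodule ℂ A := Submodule.span ℂ {a * b + b * a}
  have hM2 : M * M = Submodule.span ℂ {a * b, b * a} := by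
    rw [Submodule.span_mul_span]
    apply le_antisymm
    · rw [Submodule.span_le]
      rintro _ ⟨x, (rfl | rfl), y, (rfl | rfl), rfl⟩
      · simp [ha]
      · exact Submodule.subset_span (by simp)
      · exact Submodule.subset_span (by simp)
      · simp [hb]
    · apply Submodule.span_mono
      rintro _ (rfl | rfl)
      · exact ⟨a, by simp, b, by simp, rfl⟩
      · exact ⟨b, by simp, a, by simp, rfl⟩
  have hM3 : M * M * M ≤ S * M := by
    rw [hM2, Submodule.span_mul_span, Submodule.span_le]
    rintro _ ⟨x, (hx | hx), y, (hy | hy), rfl⟩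
    · have : a * b * a = (a * b + b * a) * a := by rw [add_mul, mul_assoc b, ha]; simp
      change x * y ∈ _
      rw [hx, hy, this]; exact Submodule.mul_mem_mul (Submodule.mem_span_singleton_self _) haM
    · rw [hx, hy]; simp [mul_assoc, hb]
    · rw [hx, hy]; simp [mul_assoc, ha]
    · have : b * a * b = (a * b + b * a) * b := by rw [add_mul, mul_assoc a, hb]; simp
      change x * y ∈ _
      rw [hx, hy, this]; exact Submodule.mul_mem_mul (Submodule.mem_span_singleton_self _) hbM
  have hMk : ∀ n, M ^ (2 * n + 1) ≤ S ^ n * M := by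
    intro n
    induction n with
    | zero => simp
    | succ n ih =>
      calc M ^ (2 * (n + 1) + 1) = M ^ (2 * n + 1) * M * M := by
            rw [← pow_succ, ← pow_succ]; congr 1
        _ ≤ S ^ n * M * M * M := by gcongr
        _ = S ^ n * (M * M * M) := by simp only [mul_assoc]
        _ ≤ S ^ n * (S * M) := by gcongr
        _ = S ^ (n + 1) * M := by rw [← mul_assoc, pow_succ]
  have hM0 : M ^ (2 * k + 1) = ⊥ := by
    rw [eq_bot_iff]
    refine (hMk k).trans ?_
    rw [Submodule.span_pow]
    simp [hk]
  let J : ℕ → Submodule ℂ A := fun n => ⨆ m : ℕ, M ^ (n + m)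
  have hJmul : ∀ i j, J i * J j ≤ J (i + j) := by
    intro i j
    simp only [J, Submodule.iSup_mul, Submodule.mul_iSup, ← pow_add]
    refine iSup_le fun p => iSup_le fun q => ?_
    refine le_trans (le_of_eq ?_) (le_iSup (fun m => M ^ (i + j + m)) (p + q))
    congr 1; omega
  have hJle : ∀ i j, i ≤ j → J j ≤ J i := by
    intro i j hij
    refine iSup_le fun p => ?_
    refine le_trans (le_of_eq ?_) (le_iSup (fun m => M ^ (i + m)) (j - i + p))
    congr 1; omega
  have hMJ : M ≤ J 1 := le_trans (by simp) (le_iSup (fun m => M ^ (1 + m)) 0)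
  have hJ0 : J (2 * k + 1) = ⊥ := by
    rw [eq_bot_iff]
    refine iSup_le fun p => ?_
    rw [pow_add, hM0, Submodule.bot_mul]
  clear_value J
  have hJm : ∀ {i j x y}, x ∈ J i → y ∈ J j → x * y ∈ J (i + j) := fun hx hy =>
    hJmul _ _ (Submodule.mul_mem_mul hx hy)
  have hG : ∀ g ∈ Subgroup.closure {α, β}, (g : A) - 1 ∈ J 1 ∧ ((g⁻¹ : Aˣ) : A) - 1 ∈ J 1 := by
    intro g hg
    obtain ⟨x, rfl⟩ := mem_closure_pair α β g hg
    have mm : ∀ y z : A, y - 1 ∈ J 1 → z - 1 ∈ J 1 → y * z - 1 ∈ J 1 := by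
      intro y z hy hz
      have : y * z - 1 = (y - 1) * (z - 1) + (y - 1) + (z - 1) := by noncomm_ring
      rw [this]
      exact add_mem (add_mem (hJle 1 (1 + 1) (by norm_num) (hJm hy hz)) hy) hz
    refine pair_ind α β α β (fun g _ => (g : A) - 1 ∈ J 1 ∧ ((g⁻¹ : Aˣ) : A) - 1 ∈ J 1)
      ?_ ?_ ?_ ?_ ?_ x
    · simp
    · intro g h _ _ hg hh
      rw [mul_inv_rev, Units.val_mul, Units.val_mul]
      exact ⟨mm _ _ hg.1 hh.1, mm _ _ hh.2 hg.2⟩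
    · intro g _ hg; rw [inv_inv]; exact ⟨hg.2, hg.1⟩
    · rw [hα, hα']
      exact ⟨by simpa using hMJ haM, by simpa using hMJ haM⟩
    · rw [hβ, hβ']
      exact ⟨by simpa using hMJ hbM, by simpa using hMJ hbM⟩
  have hcl : ∀ g ∈ Subgroup.closure {α, β}, ∀ i, ∀ x ∈ J i, x * (g : A) ∈ J i := by
    intro g hg i x hx
    have : x * (g : A) = x * ((g : A) - 1) + x := by noncomm_ring
    rw [this]
    exact add_mem (hJle i (i + 1) (by omega) (hJm hx (hG g hg).1)) hx
  let H : ℕ → Subgroup ↥(Subgroup.closure {α, β}) := fun n =>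
    { carrier := {g | ((g : Aˣ) : A) - 1 ∈ J (n + 1)}
      one_mem' := by simp
      mul_mem' := by
        intro g h hg hh
        have : (((g * h : ↥(Subgroup.closure {α, β})) : Aˣ) : A) - 1 =
          (((g : Aˣ) : A) - 1) * ((h : Aˣ) : A) + (((h : Aˣ) : A) - 1) := by
          rw [Subgroup.coe_mul, Units.val_mul]; noncomm_ring
        rw [Set.mem_ofPred_eq, this]
        exact add_mem (hcl _ h.2 _ _ hg) hh
      inv_mem' := by
        intro g hg
        have : (((g⁻¹ : ↥(Subgroup.closure {α, β})) : Aˣ) : A) - 1 =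
          - ((((g : Aˣ) : A) - 1) * (((g⁻¹ : ↥(Subgroup.closure {α, β})) : Aˣ) : A)) := by
          rw [sub_mul, one_mul, Subgroup.coe_inv, Units.mul_inv, neg_sub]
        rw [Set.mem_ofPred_eq, this]
        exact neg_mem (hcl _ (g⁻¹).2 _ _ hg) }
  rw [Subgroup.nilpotent_iff_finite_descending_central_series]
  refine ⟨2 * k, H, ⟨?_, ?_⟩, ?_⟩
  · rw [eq_top_iff]
    intro g _
    exact (hG g g.2).1
  · intro x n hx g
    change (((x * g * x⁻¹ * g⁻¹ : ↥(Subgroup.closure {α, β})) : Aˣ) : A) - 1 ∈ J (n + 1 + 1)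
    have hx' : ((x : Aˣ) : A) - 1 ∈ J (n + 1) := hx
    have hg' := (hG g g.2).1
    have e : (((x * g * x⁻¹ * g⁻¹ : ↥(Subgroup.closure {α, β})) : Aˣ) : A) - 1 =
        ((((x : Aˣ) : A) - 1) * (((g : Aˣ) : A) - 1) - (((g : Aˣ) : A) - 1) * (((x : Aˣ) : A) - 1))
        * (((x⁻¹ : ↥(Subgroup.closure {α, β})) : Aˣ) : A)
        * (((g⁻¹ : ↥(Subgroup.closure {α, β})) : Aˣ) : A) := by
      have : (((x : Aˣ) : A) - 1) * (((g : Aˣ) : A) - 1) - (((g : Aˣ) : A) - 1) *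
        (((x : Aˣ) : A) - 1) = ((x : Aˣ) : A) * ((g : Aˣ) : A) - ((g : Aˣ) : A) * ((x : Aˣ) : A) := by
        noncomm_ring
      rw [this, sub_mul, sub_mul, Subgroup.coe_inv, Subgroup.coe_inv, Units.mul_inv_cancel_right,
        Units.mul_inv]
      simp only [Subgroup.coe_mul, Units.val_mul, Subgroup.coe_inv]
    rw [e]
    refine hcl _ (g⁻¹).2 _ _ (hcl _ (x⁻¹).2 _ _ (sub_mem (hJm hx' hg') ?_))
    have := hJm hg' hx'
    rwa [add_comm] at this
  · rw [eq_bot_iff]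
    intro g hg
    have hg' : ((g : Aˣ) : A) - 1 ∈ J (2 * k + 1) := hg
    rw [hJ0, Submodule.mem_bot, sub_eq_zero] at hg'
    rw [Subgroup.mem_bot]
    ext
    simpa using hg'

theorem s_nilpotent_of_roots [FiniteDimensional ℂ A] (s : A)
    (h : ∀ lam : ℂ, (minpoly ℂ s).IsRoot lam → lam = 0) : ∃ k, s ^ k = 0 := by
  have hint : IsIntegral ℂ s := IsIntegral.of_finite ℂ _
  have h1 := (IsAlgClosed.splits (minpoly ℂ s)).eq_prod_roots_of_monic (minpoly.monic hint)
  have h2 : (minpoly ℂ s).roots = Multiset.replicate (minpoly ℂ s).roots.card 0 :=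
    Multiset.eq_replicate_card.mpr fun r hr => h r (Polynomial.isRoot_of_mem_roots hr)
  rw [h2] at h1
  refine ⟨(minpoly ℂ s).roots.card, ?_⟩
  have h3 := minpoly.aeval ℂ s
  rw [h1] at h3
  simpa using h3

end AlgPart

/-- **Corollary 3.2.** Let `A` be a finite-dimensional `ℂ`-algebra and `a, b ∈ A` with
`a² = b² = 0`, and `α = 1 + a`, `β = 1 + b` the corresponding units. Then:
(i) `(1+a, 1+b)` is a free pair iff some eigenvalue of `ρ(ab)` is a free point for some
irreducible representation `ρ` of `A`; and
(ii) `⟨1+a, 1+b⟩` is nilpotent iff `0` is the only eigenvalue of `ρ(ab)` for every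
irreducible representation `ρ` of `A`. -/
theorem free_pair_iff_eigenvalue_of_irredRep (A : Type) [Ring A] [Algebra ℂ A]
    [FiniteDimensional ℂ A] (a b : A) (ha : a ^ 2 = 0) (hb : b ^ 2 = 0)
    (α β : Aˣ) (hα : (α : A) = 1 + a) (hβ : (β : A) = 1 + b) :
    (IsFreePair α β ↔
      ∃ (R : IrredRep A) (lam : ℂ), (R.ρ (a * b)).HasEigenvalue lam ∧ IsFreePoint lam) ∧
    (Group.IsNilpotent ↥(Subgroup.closure {α, β}) ↔
      ∀ (R : IrredRep A) (lam : ℂ), (R.ρ (a * b)).HasEigenvalue lam → lam = 0) := by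
  refine ⟨⟨fun hf => ?_, ?_⟩, ⟨?_, fun h => ?_⟩⟩
  · by_contra hne
    refine not_free_of_roots a b ha hb α β hα hβ (fun lam h0 hr hfree => hne ?_) hf
    obtain ⟨R, hR⟩ := exists_irrep a b ha hb lam h0 hr
    exact ⟨R, lam, hR, hfree⟩
  · rintro ⟨R, lam, hR, hfree⟩
    exact free_of_eig R.ρ a b ha hb α β hα hβ lam hR hfree
  · intro hn R lam hR
    exact eig_zero_of_nilpotent R.ρ a b ha hb α β hα hβ lam hR hn
  · obtain ⟨k, hk⟩ := s_nilpotent_of_roots (a * b + b * a) (fun lam hr => by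
      by_contra h0
      obtain ⟨R, hR⟩ := exists_irrep a b ha hb lam h0 hr
      exact h0 (h R lam hR))
    exact nilpotent_of_s a b ha hb α β hα hβ k hk
end

section
/- Let G be a group, let H ≤ K be finite subgroups of G, and let x ∈ G, h ∈ H, k ∈ K be such that x⁻¹hx ∉ K. If x⁻¹kx ∉ K, then the pair (β_{x,h,H}, γ_{x⁻¹,k,K}) = (1 + (1−h)x·H̄, 1 + K̄·x⁻¹·(1−k)) is a free pair in the unit group of ℤG. -/
namespace BGFree

/-- The shear `(p, q) ↦ (p + t q, q)`. -/
def shearU {S : Type*} [CommRing S] (t : S) : Equiv.Perm (S × S) where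
  toFun z := (z.1 + t * z.2, z.2)
  invFun z := (z.1 - t * z.2, z.2)
  left_inv z := by simp
  right_inv z := by simp

/-- The shear `(p, q) ↦ (p, q + p)`. -/
def shearV (S : Type*) [CommRing S] : Equiv.Perm (S × S) where
  toFun z := (z.1, z.2 + z.1)
  invFun z := (z.1, z.2 - z.1)
  left_inv z := by simp
  right_inv z := by simp

/-- The action of the free group by shears. -/
def shear {S : Type*} [CommRing S] (t : S) : FreeGroup Bool →* Equiv.Perm (S × S) :=
  FreeGroup.lift (fun b : Bool => if b then shearU t else shearV S)

lemma shearU_zpow {S : Type*} [CommRing S] (t : S) (n : ℤ) (z : S × S) :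
    (shearU t ^ n) z = (z.1 + n * (t * z.2), z.2) := by
  have h : ∀ (n : ℕ) (z : S × S), (shearU t ^ n) z = (z.1 + n * (t * z.2), z.2) := by
    intro n
    induction n with
    | zero => intro z; simp
    | succ m ih =>
      intro z
      rw [pow_succ, Equiv.Perm.mul_apply, ih]
      simp [shearU]; ring
  obtain ⟨m, rfl | rfl⟩ := n.eq_nat_or_neg
  · simpa using h m z
  · rw [zpow_neg, Equiv.Perm.inv_eq_iff_eq, zpow_natCast, h]
    simp

lemma shearV_zpow {S : Type*} [CommRing S] (n : ℤ) (z : S × S) :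
    (shearV S ^ n) z = (z.1, z.2 + n * z.1) := by
  have h : ∀ (n : ℕ) (z : S × S), (shearV S ^ n) z = (z.1, z.2 + n * z.1) := by
    intro n
    induction n with
    | zero => intro z; simp
    | succ m ih =>
      intro z
      rw [pow_succ, Equiv.Perm.mul_apply, ih]
      simp [shearV]; ring
  obtain ⟨m, rfl | rfl⟩ := n.eq_nat_or_neg
  · simpa using h m z
  · rw [zpow_neg, Equiv.Perm.inv_eq_iff_eq, zpow_natCast, h]
    simp

/-- Ping-pong sets. -/
def ppSet (b : Bool) : Set (ℂ × ℂ) :=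
  if b then {z | 2 * ‖z.2‖ < ‖z.1‖} else {z | ‖z.1‖ < 2 * ‖z.2‖}

open scoped Pointwise in
open Cardinal in
lemma shear_injective (t : ℂ) (ht : 4 ≤ ‖t‖) : Function.Injective (shear t) := by
  have key : shear t = (Monoid.CoprodI.lift fun i : Bool => FreeGroup.lift fun _ : Unit =>
      (if i then shearU t else shearV ℂ)).comp (@freeGroupEquivCoprodI Bool).toMonoidHom := by
    ext1 i
    simp [shear]
  rw [key, MonoidHom.coe_comp]
  clear key
  refine Function.Injective.comp ?_ (MulEquiv.injective freeGroupEquivCoprodI)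
  have hn1 : ∀ n : ℤ, n ≠ 0 → (1 : ℝ) ≤ ‖(n : ℂ)‖ := by
    intro n hn
    rw [Complex.norm_intCast]
    exact_mod_cast Int.one_le_abs hn
  refine Monoid.CoprodI.lift_injective_of_ping_pong
    (H := fun _ : Bool => FreeGroup Unit)
    (fun i : Bool => FreeGroup.lift fun _ : Unit =>
      (if i then shearU t else shearV ℂ)) ?_ ppSet ?_ ?_ ?_
  · right
    use true
    rw [FreeGroup.freeGroupUnitEquivInt.cardinal_eq, Cardinal.mk_denumerable]
    exact natCast_le_aleph0
  · intro i
    cases i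
    · exact ⟨(0, 1), by simp [ppSet]⟩
    · exact ⟨(1, 0), by simp [ppSet]⟩
  · intro i j hij
    rw [Function.onFun, Set.disjoint_left]
    cases i <;> cases j <;> simp [ppSet] at hij ⊢ <;> intros <;> linarith
  · intro i j hij
    refine FreeGroup.freeGroupUnitEquivInt.forall_congr_left.mpr ?_
    intro n hne1
    have hn : n ≠ 0 := by
      rintro rfl
      apply hne1
      simp [FreeGroup.freeGroupUnitEquivInt]
    have hn' := hn1 n hn
    change FreeGroup.lift (fun _ => _) (FreeGroup.of () ^ n) • ppSet j ⊆ ppSet i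
    simp only [map_zpow, FreeGroup.lift_apply_of]
    rintro _ ⟨⟨p, q⟩, hz, rfl⟩
    cases i <;> cases j <;> simp [ppSet] at hij hz ⊢
    · simp only [shearV_zpow]
      have h1 : ‖(n : ℂ) * p‖ ≤ ‖q + n * p‖ + ‖q‖ := by
        have := norm_sub_le (q + n * p) q
        simpa using this
      rw [norm_mul] at h1
      nlinarith [norm_nonneg p]
    · simp only [shearU_zpow]
      have h1 : ‖(n : ℂ) * (t * q)‖ ≤ ‖p + n * (t * q)‖ + ‖p‖ := by
        have := norm_sub_le (p + n * (t * q)) p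
        simpa using this
      rw [norm_mul, norm_mul] at h1
      have h2 : 4 * ‖q‖ ≤ ‖t‖ * ‖q‖ := by gcongr
      nlinarith [norm_nonneg q, mul_nonneg (norm_nonneg t) (norm_nonneg q)]

lemma shear_map {S T : Type*} [CommRing S] [CommRing T] (f : S →+* T) (t : S)
    (w : FreeGroup Bool) : ∀ z : S × S,
    shear (f t) w (f z.1, f z.2) = (f (shear t w z).1, f (shear t w z).2) := by
  induction w using FreeGroup.induction_on with
  | C1 => intro z; simp
  | of b => intro z; cases b <;> simp [shear, shearU, shearV]
  | inv_of b ih =>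
    intro z
    rw [map_inv, Equiv.Perm.inv_eq_iff_eq, map_inv, ih]
    simp
  | mul a b iha ihb =>
    intro z
    rw [map_mul, Equiv.Perm.mul_apply, ihb, iha]
    simp

open Polynomial in
/-- The intertwining map. -/
noncomputable def psi {A : Type*} [Ring A] [Algebra ℂ A] (a b : A) (z : ℂ[X] × ℂ[X]) : A :=
  a * aeval (b * a) z.1 + (b * a) * aeval (b * a) z.2

open Polynomial in
lemma psi_shear {A : Type*} [Ring A] [Algebra ℂ A] (a b : A) (ha : a * a = 0) (hb : b * b = 0)
    (u v : Aˣ) (hu : (u : A) = 1 + a) (hv : (v : A) = 1 + b) (w : FreeGroup Bool) :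
    ∀ z : ℂ[X] × ℂ[X],
      ((FreeGroup.lift (fun b : Bool => if b then u else v) w : Aˣ) : A) * psi a b z
        = psi a b (shear X w z) := by
  have ha' : ∀ c, a * (a * c) = 0 := fun c => by rw [← mul_assoc, ha, zero_mul]
  have hb' : ∀ c, b * (b * c) = 0 := fun c => by rw [← mul_assoc, hb, zero_mul]
  induction w using FreeGroup.induction_on with
  | C1 => intro z; simp
  | of i =>
    intro z
    cases i
    · simp [shear, shearV, psi, hv, mul_add, add_mul, mul_assoc, hb']
      abel
    · simp [shear, shearU, psi, hu, mul_add, add_mul, mul_assoc, ha']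
      abel
  | inv_of b ih =>
    intro z
    rw [map_inv, Units.inv_mul_eq_iff_eq_mul, ih, map_inv]
    simp
  | mul c d ihc ihd =>
    intro z
    rw [map_mul, Units.val_mul, mul_assoc, ihd, ihc]
    simp

open Polynomial in
theorem free_of_root {A : Type*} [Ring A] [Algebra ℂ A] (a b : A) (ha : a * a = 0)
    (hb : b * b = 0)
    (u v : Aˣ) (hu : (u : A) = 1 + a) (hv : (v : A) = 1 + b)
    (t : ℂ) (ht : 4 ≤ ‖t‖) (hroot : ∀ p : ℂ[X], aeval (b * a) p = 0 → p.eval t = 0) :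
    Function.Injective (FreeGroup.lift (fun b : Bool => if b then u else v)) := by
  rw [injective_iff_map_eq_one]
  intro w hw
  apply shear_injective t ht
  rw [map_one]
  have ht0 : t ≠ 0 := by
    rintro rfl
    simp at ht
    linarith
  have ha' : ∀ c, a * (a * c) = 0 := fun c => by rw [← mul_assoc, ha, zero_mul]
  have hb' : ∀ c, b * (b * c) = 0 := fun c => by rw [← mul_assoc, hb, zero_mul]
  ext1 z
  have h1 := psi_shear a b ha hb u v hu hv w (C z.1, C z.2)
  rw [hw, Units.val_one, one_mul] at h1
  have h2 := shear_map (evalRingHom t) X w (C z.1, C z.2)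
  simp only [coe_evalRingHom, eval_X, eval_C] at h2
  rw [Equiv.Perm.one_apply]
  change shear t w (z.1, z.2) = _
  rw [h2]
  set m := shear X w (C z.1, C z.2) with hm
  simp only [psi] at h1
  have e1 : aeval (b * a) (X * (m.1 - C z.1)) = 0 := by
    have := congrArg (fun c => b * c) h1
    simp only [mul_add, mul_assoc, hb', add_zero] at this
    simp only [map_mul, map_sub, aeval_X, mul_sub, mul_assoc]
    rw [this, sub_self]
  have e2 : aeval (b * a) (X * (X * (m.2 - C z.2))) = 0 := by
    have := congrArg (fun c => b * (a * c)) h1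
    simp only [mul_add, mul_assoc, ha', zero_add] at this
    simp only [map_mul, map_sub, aeval_X, mul_sub, mul_assoc]
    rw [this, sub_self]
  have f1 := hroot _ e1
  have f2 := hroot _ e2
  simp [ht0, sub_eq_zero] at f1 f2
  rw [f1, f2]

end BGFree

namespace BGFree

section Trace

set_option linter.unusedSectionVars false

variable {G : Type*} [Group G] {E : Type*} [NormedAddCommGroup E] [InnerProductSpace ℂ E]
  [CompleteSpace E]

lemma dense_basis {ι : Type*} (d : HilbertBasis ι ℂ E) :
    Dense (Submodule.span ℂ (Set.range d) : Set E) := by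
  rw [Submodule.dense_iff_topologicalClosure_eq_top]
  exact d.dense_span

lemma exists_perm_op {ι : Type*} (d : HilbertBasis ι ℂ E) (σ : Equiv.Perm ι) :
    ∃ T : E →L[ℂ] E, ∀ i, T (d i) = d (σ i) := by
  have ho : Orthonormal ℂ (fun i => d (σ i)) := d.orthonormal.comp σ σ.injective
  have hr : Set.range (fun i => d (σ i)) = Set.range d := σ.surjective.range_comp d
  let d' : HilbertBasis ι ℂ E := HilbertBasis.mk ho (by rw [hr, d.dense_span])
  have hd' : ∀ i, d' i = d (σ i) := fun i => congrFun (HilbertBasis.coe_mk ho _) i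
  refine ⟨((d.repr.trans d'.repr.symm).toContinuousLinearEquiv : E →L[ℂ] E), fun i => ?_⟩
  classical
  simp [HilbertBasis.repr_self, HilbertBasis.repr_symm_single, hd']

/-- The operator permuting the basis. -/
noncomputable def permOp {ι : Type*} (d : HilbertBasis ι ℂ E) (σ : Equiv.Perm ι) : E →L[ℂ] E :=
  (exists_perm_op d σ).choose

@[simp] lemma permOp_apply {ι : Type*} (d : HilbertBasis ι ℂ E) (σ : Equiv.Perm ι) (i : ι) :
    permOp d σ (d i) = d (σ i) := (exists_perm_op d σ).choose_spec i

lemma op_ext {ι : Type*} (d : HilbertBasis ι ℂ E) {S T : E →L[ℂ] E} (h : ∀ i, S (d i) = T (d i)) :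
    S = T := by
  refine ContinuousLinearMap.ext_on (dense_basis d) ?_
  rintro _ ⟨i, rfl⟩
  exact h i

lemma permOp_mul {ι : Type*} (d : HilbertBasis ι ℂ E) (σ τ : Equiv.Perm ι) :
    permOp d (σ * τ) = permOp d σ * permOp d τ := op_ext d (by simp)

lemma permOp_one {ι : Type*} (d : HilbertBasis ι ℂ E) :
    permOp d 1 = 1 := op_ext d (by simp)

lemma permOp_adj {ι : Type*} (d : HilbertBasis ι ℂ E) (σ : Equiv.Perm ι) (v w : E) :
    inner ℂ v (permOp d σ w) = inner ℂ (permOp d σ⁻¹ v) w := by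
  have : permOp d σ = ContinuousLinearMap.adjoint (permOp d σ⁻¹) := by
    refine op_ext d fun i => ?_
    apply d.repr.injective
    ext j
    classical
    have := orthonormal_iff_ite.mp d.orthonormal
    rw [d.repr_apply_apply, d.repr_apply_apply, ContinuousLinearMap.adjoint_inner_right]
    simp only [permOp_apply, this]
    congr 1
    rw [eq_iff_iff, Equiv.Perm.inv_eq_iff_eq]
  rw [this, ContinuousLinearMap.adjoint_inner_right]

variable (d : HilbertBasis G ℂ E)

/-- Left translation. -/
noncomputable def lop (g : G) : E →L[ℂ] E := permOp d (Equiv.mulLeft g)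

/-- Right translation. -/
noncomputable def rop (g : G) : E →L[ℂ] E := permOp d (Equiv.mulRight g)

/-- Operators commuting with right translations. -/
def Inv (T : E →L[ℂ] E) : Prop := ∀ g, T * rop d g = rop d g * T

/-- The trace. -/
noncomputable def tr (T : E →L[ℂ] E) : ℂ := inner ℂ (d 1) (T (d 1))

variable {d}

lemma Inv.mul {S T : E →L[ℂ] E} (hS : Inv d S) (hT : Inv d T) : Inv d (S * T) := fun g => by
  rw [mul_assoc, hT g, ← mul_assoc, hS g, mul_assoc]

lemma Inv.add {S T : E →L[ℂ] E} (hS : Inv d S) (hT : Inv d T) : Inv d (S + T) := fun g => by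
  rw [add_mul, mul_add, hS g, hT g]

lemma Inv.sub {S T : E →L[ℂ] E} (hS : Inv d S) (hT : Inv d T) : Inv d (S - T) := fun g => by
  rw [sub_mul, mul_sub, hS g, hT g]

lemma Inv.smul (c : ℂ) {T : E →L[ℂ] E} (hT : Inv d T) : Inv d (c • T) := fun g => by
  rw [smul_mul_assoc, mul_smul_comm, hT g]

lemma inv_one : Inv d 1 := fun g => by simp

lemma inv_lop (g : G) : Inv d (lop d g) := fun g' => by
  refine op_ext d fun i => ?_
  simp [lop, rop, mul_assoc]

lemma tr_add (S T : E →L[ℂ] E) : tr d (S + T) = tr d S + tr d T := by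
  simp [tr, inner_add_right]

lemma tr_sub (S T : E →L[ℂ] E) : tr d (S - T) = tr d S - tr d T := by
  simp [tr, inner_sub_right]

lemma tr_smul (c : ℂ) (T : E →L[ℂ] E) : tr d (c • T) = c * tr d T := by
  simp [tr, inner_smul_right]

lemma Inv.entry {T : E →L[ℂ] E} (hT : Inv d T) (g : G) :
    inner ℂ (d 1) (T (d g)) = inner ℂ (d g⁻¹) (T (d 1)) := by
  have h1 : d g = rop d g (d 1) := by simp [rop]
  have h2 : T (d g) = rop d g (T (d 1)) := by
    rw [h1]; exact DFunLike.congr_fun (hT g) (d 1)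
  rw [h2, rop, permOp_adj, permOp_apply]
  congr 2
  rw [Equiv.Perm.inv_eq_iff_eq]; simp

lemma tr_comm {S T : E →L[ℂ] E} (hS : Inv d S) (hT : Inv d T) : tr d (S * T) = tr d (T * S) := by
  have key : ∀ {S T : E →L[ℂ] E} (_ : Inv d S) (_ : Inv d T),
      tr d (S * T) = ∑' g, inner ℂ (d g⁻¹) (S (d 1)) * inner ℂ (d g) (T (d 1)) := by
    intro S T hS hT
    rw [tr, mul_apply_eq_comp, ← ContinuousLinearMap.adjoint_inner_left,
      ← d.tsum_inner_mul_inner]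
    refine tsum_congr fun g => ?_
    rw [ContinuousLinearMap.adjoint_inner_left, hS.entry]
  rw [key hS hT, key hT hS, ← (Equiv.inv G).tsum_eq]
  refine tsum_congr fun g => ?_
  simp [mul_comm]

lemma inv_proj (V : Submodule ℂ E) [V.HasOrthogonalProjection]
    (hV : ∀ g, ∀ v ∈ V, rop d g v ∈ V) : Inv d V.starProjection := by
  intro g
  ext v
  simp only [mul_apply_eq_comp]
  refine (Submodule.eq_starProjection_of_mem_orthogonal (hV g _ (by simp)) ?_)
  rw [← map_sub, Submodule.mem_orthogonal]
  intro w hw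
  rw [rop, permOp_adj]
  have h1 : (Equiv.mulRight g)⁻¹ = Equiv.mulRight g⁻¹ := by
    ext x; rw [Equiv.Perm.inv_eq_iff_eq]; simp
  rw [h1]
  exact (Submodule.mem_orthogonal _ _).1 (Submodule.sub_starProjection_mem_orthogonal v) _
    (hV g⁻¹ w hw)

lemma tr_proj (V : Submodule ℂ E) [V.HasOrthogonalProjection] :
    tr d V.starProjection = ((‖V.starProjection (d 1)‖ ^ 2 : ℝ) : ℂ) := by
  have h : V.starProjection (d 1) = V.starProjection (V.starProjection (d 1)) :=
    (Submodule.starProjection_eq_self_iff.mpr (by simp)).symm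
  rw [tr, h, ← Submodule.inner_starProjection_left_eq_right, inner_self_eq_norm_sq_to_K]
  rw [← h]
  simp

/-- The chain of subspaces. -/
def chainV (W : Submodule ℂ E) (y : E →L[ℂ] E) : List ℂ → Submodule ℂ E
  | [] => ⊥
  | c :: l => W ⊓ (chainV W y l).comap ((y - c • 1 : E →L[ℂ] E) : E →ₗ[ℂ] E)

variable {W : Submodule ℂ E} {y : E →L[ℂ] E}

lemma chainV_closed (hW : IsClosed (W : Set E)) (l : List ℂ) :
    IsClosed (chainV W y l : Set E) := by
  induction l with
  | nil => simp [chainV]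
  | cons c l ih => exact hW.inter (ih.preimage (y - c • 1 : E →L[ℂ] E).continuous)

lemma chainV_inv (hW : ∀ g, ∀ v ∈ W, rop d g v ∈ W) (hy : Inv d y) (l : List ℂ) :
    ∀ g, ∀ v ∈ chainV W y l, rop d g v ∈ chainV W y l := by
  induction l with
  | nil => intro g v hv; simp [chainV] at hv ⊢; simp [hv]
  | cons c l ih =>
    intro g v hv
    refine ⟨hW g v hv.1, ?_⟩
    have h1 : (y - c • 1) * rop d g = rop d g * (y - c • 1) := (hy.sub (inv_one.smul c)) g
    have h2 := DFunLike.congr_fun h1 v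
    change (y - c • 1) (rop d g v) ∈ chainV W y l
    change ((y - c • 1) * rop d g) v ∈ chainV W y l
    rw [h2]
    exact ih g _ hv.2

lemma chainV_le (l : List ℂ) : chainV W y l ≤ W := by
  cases l with
  | nil => exact bot_le
  | cons c l => exact inf_le_left

lemma chainV_y (hWy : ∀ v ∈ W, y v ∈ W) (l : List ℂ) : ∀ v ∈ chainV W y l, y v ∈ chainV W y l := by
  induction l with
  | nil => intro v hv; simp [chainV] at hv ⊢; simp [hv]
  | cons c l ih =>
    intro v hv
    refine ⟨hWy v hv.1, ?_⟩
    change (y - c • 1) (y v) ∈ chainV W y l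
    have : (y - c • 1) (y v) = y ((y - c • 1) v) := by simp
    rw [this]
    exact ih _ hv.2

lemma chainV_mono (hWy : ∀ v ∈ W, y v ∈ W) (c : ℂ) (l : List ℂ) :
    chainV W y l ≤ chainV W y (c :: l) := by
  intro v hv
  refine ⟨chainV_le l hv, ?_⟩
  change (y - c • 1) v ∈ chainV W y l
  simpa using sub_mem (chainV_y hWy l v hv) (Submodule.smul_mem _ c hv)

lemma chain_bound (hWc : IsClosed (W : Set E)) (hW : ∀ g, ∀ v ∈ W, rop d g v ∈ W)
    (hy : Inv d y) (hWy : ∀ v ∈ W, y v ∈ W) (r : ℝ) (l : List ℂ) (hl : ∀ c ∈ l, ‖c‖ ≤ r) :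
    ∀ (V : Submodule ℂ E) [V.HasOrthogonalProjection], V = chainV W y l →
    ‖tr d (y * V.starProjection)‖ ≤ r * ‖V.starProjection (d 1)‖ ^ 2 := by
  induction l with
  | nil =>
    intro V _ hV
    subst hV
    have : ∀ v, (chainV W y []).starProjection v = 0 := fun v => by
      have : (chainV W y []).starProjection v ∈ chainV W y [] := by simp
      simpa [chainV] using this
    simp [tr, this]
  | cons c l ih =>
    intro V' _ hV'
    set V := chainV W y l with hV
    have : CompleteSpace V := (chainV_closed hWc l).completeSpace_coe
    have ih' := ih (fun c hc => hl c (by simp [hc])) V rfl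
    have hle : V ≤ V' := by rw [hV']; exact chainV_mono hWy c l
    set P := V.starProjection with hP
    set P' := V'.starProjection with hP'
    have iP : Inv d P := inv_proj V (chainV_inv hW hy l)
    have iP' : Inv d P' := inv_proj V' (by rw [hV']; exact chainV_inv hW hy _)
    have hP'P : P' * P = P := by
      ext v
      exact Submodule.starProjection_eq_self_iff.mpr (hle (by simp [hP]))
    have hPP : P * P = P := V.isIdempotentElem_starProjection
    have hPP' : P * P' = P := by
      ext v
      have h0 : P (v - P' v) = 0 := by
        rw [hP, Submodule.starProjection_apply_eq_zero_iff]
        exact Submodule.orthogonal_le hle (Submodule.sub_starProjection_mem_orthogonal v)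
      rw [map_sub, sub_eq_zero] at h0
      exact h0.symm
    set Z := (y - c • 1) * (P' - P) with hZ
    have hPZ : P * Z = Z := by
      ext v
      refine Submodule.starProjection_eq_self_iff.mpr ?_
      have : (P' - P) v ∈ V' := sub_mem (by simp [hP']) (hle (by simp [hP]))
      rw [hV'] at this
      exact this.2
    have hZP : Z * P = 0 := by
      rw [hZ, mul_assoc, sub_mul P' P P, hP'P, hPP, sub_self, mul_zero]
    have iZ : Inv d Z := (hy.sub (inv_one.smul c)).mul (iP'.sub iP)
    have htZ : tr d Z = 0 := by
      rw [← hPZ, tr_comm iP iZ, hZP]; simp [tr]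
    have hsplit : y * P' = y * P + c • (P' - P) + Z := by
      rw [hZ, sub_mul, smul_mul_assoc, one_mul, mul_sub]; abel
    have hnorm : ‖P (d 1)‖ ≤ ‖P' (d 1)‖ := by
      have : P (d 1) = P (P' (d 1)) := (DFunLike.congr_fun hPP' (d 1)).symm
      rw [this]
      exact V.norm_starProjection_apply_le _
    have hsq : ‖P (d 1)‖ ^ 2 ≤ ‖P' (d 1)‖ ^ 2 := by gcongr
    rw [hsplit, tr_add, tr_add, tr_smul, tr_sub, htZ, add_zero, hP, hP', tr_proj, tr_proj,
      ← Complex.ofReal_sub]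
    rw [← hP, ← hP']
    refine (norm_add_le _ _).trans ?_
    rw [norm_mul, Complex.norm_real, Real.norm_of_nonneg (by linarith)]
    have hc : ‖c‖ ≤ r := hl c (by simp)
    nlinarith [mul_le_mul_of_nonneg_right hc (sub_nonneg.2 hsq)]

lemma mem_chainV (hWy : ∀ v ∈ W, y v ∈ W) (l : List ℂ) : ∀ v ∈ W,
    Polynomial.aeval y ((l.map fun c => Polynomial.X - Polynomial.C c).prod) v = 0 →
      v ∈ chainV W y l := by
  induction l with
  | nil => intro v _ h; simpa [chainV] using h
  | cons c l ih =>
    intro v hv h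
    refine ⟨hv, ?_⟩
    apply ih
    · change (y - c • 1) v ∈ W
      simpa using sub_mem (hWy v hv) (Submodule.smul_mem _ c hv)
    · rw [List.map_cons, List.prod_cons, mul_comm, map_mul, mul_apply_eq_comp] at h
      rw [← h]
      simp [Algebra.algebraMap_eq_smul_one]

open Polynomial in
/-- Existence of a large spectral value. -/
theorem exists_root (hWc : IsClosed (W : Set E)) (hW : ∀ g, ∀ v ∈ W, rop d g v ∈ W)
    (hy : Inv d y) (hWy : ∀ v, y v ∈ W) [W.HasOrthogonalProjection]
    (hbig : 4 * ‖W.starProjection (d 1)‖ ^ 2 ≤ ‖tr d y‖) (hpos : 0 < ‖tr d y‖) :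
    ∃ t : ℂ, 4 ≤ ‖t‖ ∧ ∀ p : ℂ[X], aeval y p = 0 → p.eval t = 0 := by
  by_cases halg : IsIntegral ℂ y
  · by_contra! hcon
    have hm := minpoly.monic halg
    have hsplit := IsAlgClosed.splits (minpoly ℂ y)
    have hroots : ∀ c ∈ (minpoly ℂ y).roots.toList, ‖c‖ < 4 := by
      intro c hc
      by_contra! h4
      obtain ⟨p, hp, hpc⟩ := hcon c h4
      obtain ⟨q, rfl⟩ := minpoly.dvd ℂ y hp
      rw [Multiset.mem_toList, mem_roots hm.ne_zero] at hc
      apply hpc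
      rw [eval_mul, hc.eq_zero, zero_mul]
    obtain ⟨r, hr4, hr⟩ : ∃ r < 4, ∀ c ∈ (minpoly ℂ y).roots.toList, ‖c‖ ≤ r := by
      generalize (minpoly ℂ y).roots.toList = l at hroots
      induction l with
      | nil => exact ⟨0, by norm_num, by simp⟩
      | cons c l ih =>
        obtain ⟨r, h1, h2⟩ := ih (fun c hc => hroots c (by simp [hc]))
        refine ⟨max r ‖c‖, max_lt h1 (hroots c (by simp)), ?_⟩
        intro c' hc'
        rcases List.mem_cons.1 hc' with rfl | h
        · exact le_max_right _ _
        · exact (h2 _ h).trans (le_max_left _ _)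
    have hprod : (((minpoly ℂ y).roots.toList).map fun c => X - C c).prod = minpoly ℂ y := by
      rw [← Multiset.prod_coe, ← Multiset.map_coe, Multiset.coe_toList]
      exact (hsplit.eq_prod_roots_of_monic hm).symm
    have hWV : W = chainV W y (minpoly ℂ y).roots.toList := by
      apply le_antisymm _ (chainV_le _)
      intro v hv
      apply mem_chainV (fun v _ => hWy v) _ v hv
      rw [hprod, minpoly.aeval]; rfl
    have hb := chain_bound hWc hW hy (fun v _ => hWy v) r _ hr W hWV
    rw [tr_comm hy (inv_proj W hW)] at hb
    have : W.starProjection * y = y := by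
      ext v
      exact Submodule.starProjection_eq_self_iff.mpr (hWy v)
    rw [this] at hb
    have h0 : 0 ≤ ‖W.starProjection (d 1)‖ ^ 2 := by positivity
    rcases h0.eq_or_lt with h | h
    · rw [← h] at hb; linarith
    · nlinarith
  · refine ⟨4, by simp, fun p hp => ?_⟩
    have : p = 0 := by
      by_contra h0
      exact halg (isAlgebraic_iff_isIntegral.1 ⟨p, h0, hp⟩)
    simp [this]

end Trace

end BGFree

namespace BGFree

section Final

variable {G : Type*} [Group G] {E : Type*} [NormedAddCommGroup E] [InnerProductSpace ℂ E]
  [CompleteSpace E]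

/-- The left regular representation as a ring homomorphism. -/
noncomputable def rho (d : HilbertBasis G ℂ E) : MonoidAlgebra ℤ G →ₐ[ℤ] (E →L[ℂ] E) :=
  MonoidAlgebra.lift ℤ (E →L[ℂ] E) G
    { toFun := lop d
      map_one' := by
        rw [lop, ← permOp_one d]; congr 1; ext; simp
      map_mul' := fun a b => by
        rw [lop, lop, lop, ← permOp_mul d]; congr 1; ext; simp [mul_assoc] }

lemma rho_of (d : HilbertBasis G ℂ E) (g : G) : rho d (MonoidAlgebra.of ℤ G g) = lop d g := by
  simp [rho]

lemma inv_rho (d : HilbertBasis G ℂ E) (z : MonoidAlgebra ℤ G) : Inv d (rho d z) := by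
  induction z using MonoidAlgebra.induction_on with
  | of g => rw [rho_of]; exact inv_lop g
  | add f g hf hg => rw [map_add]; exact hf.add hg
  | smul r f hf =>
    rw [map_smul, ← Int.cast_smul_eq_zsmul ℂ]; exact hf.smul _

lemma tr_rho (d : HilbertBasis G ℂ E) (z : MonoidAlgebra ℤ G) :
    tr d (rho d z) = ((z.coeff 1 : ℤ) : ℂ) := by
  classical
  induction z using MonoidAlgebra.induction_on with
  | of g =>
    rw [rho_of, tr, lop, permOp_apply, orthonormal_iff_ite.mp d.orthonormal]
    simp [MonoidAlgebra.of_apply, Finsupp.single_apply, eq_comm]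
  | add f g hf hg => rw [map_add, tr_add, hf, hg]; simp
  | smul r f hf =>
    rw [map_smul, ← Int.cast_smul_eq_zsmul ℂ, tr_smul, hf, MonoidAlgebra.coeff_smul]; simp

/-- Sum over a finite subgroup. -/
noncomputable def hat (H : Subgroup G) [Fintype H] : MonoidAlgebra ℤ G :=
  ∑ g : H, MonoidAlgebra.of ℤ G (g : G)

lemma of_mul_hat (H : Subgroup G) [Fintype H] {h : G} (hh : h ∈ H) :
    MonoidAlgebra.of ℤ G h * hat H = hat H := by
  rw [hat, Finset.mul_sum]
  refine Fintype.sum_equiv (Equiv.mulLeft (⟨h, hh⟩ : H)) _ _ fun g => ?_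
  simp only [← map_mul]; rfl

lemma hat_mul_of (H : Subgroup G) [Fintype H] {h : G} (hh : h ∈ H) :
    hat H * MonoidAlgebra.of ℤ G h = hat H := by
  rw [hat, Finset.sum_mul]
  refine Fintype.sum_equiv (Equiv.mulRight (⟨h, hh⟩ : H)) _ _ fun g => ?_
  simp only [← map_mul]; rfl

lemma hat_mul_hat (H : Subgroup G) [Fintype H] :
    hat H * hat H = (Fintype.card H) • hat H := by
  conv_lhs => enter [1]; rw [hat]
  rw [Finset.sum_mul, Finset.sum_congr rfl fun g _ => of_mul_hat H g.2]
  simp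

lemma hat_coeff_one (H : Subgroup G) [Fintype H] : (hat H).coeff 1 = 1 := by
  classical
  simp [hat, MonoidAlgebra.of_apply, Finsupp.single_apply, MonoidAlgebra.coeff_sum,
    Finsupp.finsetSum_apply]

lemma coeff_ba (H K : Subgroup G) [Fintype H] [Fintype K] (hHK : H ≤ K) (x h k : G)
    (hconj_h : x⁻¹ * h * x ∉ K) (hconj_k : x⁻¹ * k * x ∉ K) :
    (Fintype.card H : ℤ) ≤ ((hat K * MonoidAlgebra.of ℤ G x⁻¹ * (1 - MonoidAlgebra.of ℤ G k)) *
      ((1 - MonoidAlgebra.of ℤ G h) * MonoidAlgebra.of ℤ G x * hat H)).coeff 1 := by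
  classical
  have e : (hat K * MonoidAlgebra.of ℤ G x⁻¹ * (1 - MonoidAlgebra.of ℤ G k)) *
      ((1 - MonoidAlgebra.of ℤ G h) * MonoidAlgebra.of ℤ G x * hat H) =
      ∑ g' : H, ∑ g : K, (MonoidAlgebra.of ℤ G ((g : G) * g')
        - MonoidAlgebra.of ℤ G ((g : G) * (x⁻¹ * k * x) * g')
        - MonoidAlgebra.of ℤ G ((g : G) * (x⁻¹ * h * x) * g')
        + MonoidAlgebra.of ℤ G ((g : G) * (x⁻¹ * k * h * x) * g')) := by
    have hx : MonoidAlgebra.of ℤ G x⁻¹ * MonoidAlgebra.of ℤ G x = 1 := by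
      rw [← map_mul, inv_mul_cancel, map_one]
    have e1 : (hat K * MonoidAlgebra.of ℤ G x⁻¹ * (1 - MonoidAlgebra.of ℤ G k)) *
      ((1 - MonoidAlgebra.of ℤ G h) * MonoidAlgebra.of ℤ G x * hat H) =
      hat K * (MonoidAlgebra.of ℤ G x⁻¹ * MonoidAlgebra.of ℤ G x
        - MonoidAlgebra.of ℤ G (x⁻¹ * k * x) - MonoidAlgebra.of ℤ G (x⁻¹ * h * x)
        + MonoidAlgebra.of ℤ G (x⁻¹ * k * h * x)) * hat H := by
      simp only [map_mul]
      noncomm_ring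
    rw [e1, hx, hat, hat, Finset.mul_sum]
    refine Finset.sum_congr rfl fun g' _ => ?_
    rw [Finset.sum_mul, Finset.sum_mul]
    refine Finset.sum_congr rfl fun g _ => ?_
    simp only [map_mul]
    noncomm_ring
  rw [e]
  simp only [MonoidAlgebra.coeff_sum, Finsupp.finsetSum_apply]
  have hc : (Fintype.card H : ℤ) = ∑ g' : H, 1 := by simp
  rw [hc]
  refine Finset.sum_le_sum fun g' _ => ?_
  have h1 : (1 : ℤ) = ∑ g : K, if g = (⟨(g' : G), hHK g'.2⟩ : K)⁻¹ then 1 else 0 := by simp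
  rw [h1]
  refine Finset.sum_le_sum fun g _ => ?_
  have no : ∀ m : G, m ∉ K → (g : G) * m * g' ≠ 1 := by
    intro m hm h0
    apply hm
    have : m = (g : G)⁻¹ * (g' : G)⁻¹ := by
      rw [eq_mul_inv_iff_mul_eq]
      apply eq_inv_of_mul_eq_one_right
      rw [← mul_assoc, h0]
    rw [this]
    exact K.mul_mem (K.inv_mem g.2) (K.inv_mem (hHK g'.2))
  have h3 : (g = (⟨(g' : G), hHK g'.2⟩ : K)⁻¹) ↔ (g : G) * g' = 1 := by
    rw [Subtype.ext_iff, mul_eq_one_iff_eq_inv]; rfl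
  simp only [MonoidAlgebra.of_apply, MonoidAlgebra.coeff_add, MonoidAlgebra.coeff_sub,
    MonoidAlgebra.coeff_single, Finsupp.add_apply, Finsupp.sub_apply, Finsupp.single_apply,
    if_neg (no _ hconj_h), if_neg (no _ hconj_k), h3]
  split_ifs <;> simp

end Final

end BGFree

open BGFree in
/-- **Proposition 4.2(1).** Let `H ≤ K` be finite subgroups of a group `G`, and let
`x ∈ G`, `h ∈ H`, `k ∈ K` with `x⁻¹hx ∉ K`. If `x⁻¹kx ∉ K`, then the generalized
bicyclic units `β_{x,h,H} = 1 + (1−h)·x·H̄` and `γ_{x⁻¹,k,K} = 1 + K̄·x⁻¹·(1−k)`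
form a free pair in the unit group of `ℤG`. -/
theorem beta_gamma_free_pair (G : Type*) [Group G] (H K : Subgroup G)
    [Fintype H] [Fintype K] (hHK : H ≤ K) (x h k : G) (hh : h ∈ H) (hk : k ∈ K)
    (hconj_h : x⁻¹ * h * x ∉ K) (hconj_k : x⁻¹ * k * x ∉ K)
    (u v : (MonoidAlgebra ℤ G)ˣ)
    (hu : (u : MonoidAlgebra ℤ G) =
      1 + (1 - MonoidAlgebra.of ℤ G h) * MonoidAlgebra.of ℤ G x *
        ∑ g : H, MonoidAlgebra.of ℤ G (g : G))
    (hv : (v : MonoidAlgebra ℤ G) =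
      1 + (∑ g : K, MonoidAlgebra.of ℤ G (g : G)) * MonoidAlgebra.of ℤ G x⁻¹ *
        (1 - MonoidAlgebra.of ℤ G k)) :
    IsFreePair u v := by
  classical
  change (u : MonoidAlgebra ℤ G) = 1 + (1 - MonoidAlgebra.of ℤ G h) * MonoidAlgebra.of ℤ G x *
        hat H at hu
  change (v : MonoidAlgebra ℤ G) = 1 + hat K * MonoidAlgebra.of ℤ G x⁻¹ *
        (1 - MonoidAlgebra.of ℤ G k) at hv
  have hcb := coeff_ba H K hHK x h k hconj_h hconj_k
  set a := (1 - MonoidAlgebra.of ℤ G h) * MonoidAlgebra.of ℤ G x * hat H with ha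
  set b := hat K * MonoidAlgebra.of ℤ G x⁻¹ * (1 - MonoidAlgebra.of ℤ G k) with hb
  have haa : a * a = 0 := by
    have : hat H * (1 - MonoidAlgebra.of ℤ G h) = 0 := by
      rw [mul_sub, mul_one, hat_mul_of H hh, sub_self]
    calc a * a = (1 - MonoidAlgebra.of ℤ G h) * MonoidAlgebra.of ℤ G x *
          (hat H * (1 - MonoidAlgebra.of ℤ G h)) * (MonoidAlgebra.of ℤ G x * hat H) := by
            rw [ha]; simp only [mul_assoc]
      _ = 0 := by rw [this]; simp
  have hbb : b * b = 0 := by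
    have : (1 - MonoidAlgebra.of ℤ G k) * hat K = 0 := by
      rw [sub_mul, one_mul, of_mul_hat K hk, sub_self]
    calc b * b = hat K * MonoidAlgebra.of ℤ G x⁻¹ *
          ((1 - MonoidAlgebra.of ℤ G k) * hat K) * (MonoidAlgebra.of ℤ G x⁻¹ *
            (1 - MonoidAlgebra.of ℤ G k)) := by
            rw [hb]; simp only [mul_assoc]
      _ = 0 := by rw [this]; simp
  have hKb : hat K * b = (Fintype.card K) • b := by
    rw [hb, ← mul_assoc, ← mul_assoc, hat_mul_hat, smul_mul_assoc, smul_mul_assoc]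
  have hcH : 2 ≤ Fintype.card H := by
    refine Fintype.one_lt_card_iff.2 ⟨⟨h, hh⟩, 1, ?_⟩
    intro h0
    have h1 : h = 1 := congrArg Subtype.val h0
    apply hconj_h
    simp [h1, K.one_mem]
  have hcK : 2 ≤ Fintype.card K := by
    refine Fintype.one_lt_card_iff.2 ⟨⟨k, hk⟩, 1, ?_⟩
    intro h0
    have h1 : k = 1 := congrArg Subtype.val h0
    apply hconj_k
    simp [h1, K.one_mem]
  let d : HilbertBasis G ℂ (lp (fun _ : G => ℂ) 2) := default
  set n := Fintype.card K with hn
  let Kop := rho d (hat K)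
  let W : Submodule ℂ (lp (fun _ : G => ℂ) 2) :=
    LinearMap.ker ((Kop - (n : ℂ) • 1 : _ →L[ℂ] _) : _ →ₗ[ℂ] (lp (fun _ : G => ℂ) 2))
  have memW : ∀ w, w ∈ W ↔ Kop w = (n : ℂ) • w := by
    intro w
    change (Kop - (n : ℂ) • 1) w = 0 ↔ _
    simp [sub_eq_zero]
  have hWc : IsClosed (W : Set (lp (fun _ : G => ℂ) 2)) :=
    ContinuousLinearMap.isClosed_ker (Kop - (n : ℂ) • 1 : _ →L[ℂ] (lp (fun _ : G => ℂ) 2))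
  have : CompleteSpace W := hWc.completeSpace_coe
  have hKinv : Inv d Kop := inv_rho d _
  have hW : ∀ g, ∀ w ∈ W, rop d g w ∈ W := by
    intro g w hw
    rw [memW] at hw ⊢
    have := DFunLike.congr_fun (hKinv g) w
    simp only [mul_apply_eq_comp] at this
    rw [this, hw, map_smul]
  have hcomp : ∀ z : MonoidAlgebra ℤ G, hat K * z = n • z → ∀ w, rho d z w ∈ W := by
    intro z hz w
    rw [memW]
    have := DFunLike.congr_fun (congrArg (rho d) hz) w
    rw [map_mul, map_nsmul, mul_apply_eq_comp] at this
    rw [this, Nat.cast_smul_eq_nsmul]; rfl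
  have hWy : ∀ w, rho d (b * a) w ∈ W := by
    apply hcomp
    rw [← mul_assoc, hKb, smul_mul_assoc]
  have hPK : W.starProjection * Kop = Kop := by
    ext1 w
    exact Submodule.starProjection_eq_self_iff.mpr (hcomp _ (hat_mul_hat K) w)
  have hKP : Kop * W.starProjection = (n : ℂ) • W.starProjection := by
    ext1 w
    exact (memW _).1 (by simp)
  have htP : (n : ℝ) * ‖W.starProjection (d 1)‖ ^ 2 = 1 := by
    have h1 := tr_comm hKinv (inv_proj W hW)
    rw [hPK, hKP, tr_smul, tr_proj, tr_rho, hat_coeff_one] at h1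
    exact_mod_cast h1
  have hty : (2 : ℝ) ≤ ‖tr d (rho d (b * a))‖ := by
    rw [tr_rho, Complex.norm_intCast]
    have : (2 : ℤ) ≤ (b * a).coeff 1 := le_trans (by exact_mod_cast hcH) hcb
    refine le_trans ?_ (le_abs_self _)
    exact_mod_cast this
  have hbig : 4 * ‖W.starProjection (d 1)‖ ^ 2 ≤ ‖tr d (rho d (b * a))‖ := by
    refine le_trans ?_ hty
    have h2 : (2 : ℝ) ≤ n := by exact_mod_cast hcK
    nlinarith [sq_nonneg ‖W.starProjection (d 1)‖]
  obtain ⟨t, ht, hroot⟩ := exists_root hWc hW (inv_rho d _) hWy hbig (by linarith)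
  let rm : MonoidAlgebra ℤ G →* (lp (fun _ : G => ℂ) 2 →L[ℂ] lp (fun _ : G => ℂ) 2) :=
    (rho d).toRingHom.toMonoidHom
  have hrm : ∀ z, rm z = rho d z := fun _ => rfl
  have hfree := free_of_root (rho d a) (rho d b) (by rw [← map_mul, haa, map_zero])
    (by rw [← map_mul, hbb, map_zero])
    (Units.map rm u) (Units.map rm v)
    (by simp [hrm, hu]) (by simp [hrm, hv]) t ht (by rw [← map_mul]; exact hroot)
  have hcompat : FreeGroup.lift (fun i : Bool => if i then Units.map rm u
      else Units.map rm v) = (Units.map rm).comp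
        (FreeGroup.lift (fun i : Bool => if i then u else v)) := by
    ext1 i
    cases i <;> simp
  rw [hcompat, MonoidHom.coe_comp] at hfree
  exact hfree.of_comp
end

section
/- Let G be a group, let H ≤ K be finite subgroups of G, and let x ∈ G, h ∈ H, k ∈ K be such that x⁻¹hx ∉ K. If xkx⁻¹ ∉ K, then the pair (β_{x,h,H}, β_{x⁻¹,xkx⁻¹,xKx⁻¹}) = (1 + (1−h)x·H̄, 1 + (1−xkx⁻¹)x⁻¹·(xKx⁻¹)‾) is a free pair in the unit group of ℤG, where (xKx⁻¹)‾ = ∑_{g ∈ xKx⁻¹} g. -/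
namespace BetaFree

open Polynomial

/-- The shear `(p, q) ↦ (p + t q, q)`. -/
def shearU {R : Type*} [CommRing R] (t : R) : Equiv.Perm (R × R) where
  toFun v := (v.1 + t * v.2, v.2)
  invFun v := (v.1 - t * v.2, v.2)
  left_inv v := by simp
  right_inv v := by simp

/-- The shear `(p, q) ↦ (p, q + p)`. -/
def shearV (R : Type*) [CommRing R] : Equiv.Perm (R × R) where
  toFun v := (v.1, v.2 + v.1)
  invFun v := (v.1, v.2 - v.1)
  left_inv v := by simp
  right_inv v := by simp

/-- The action of the free group on `R × R` by shears. -/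
def rho {R : Type*} [CommRing R] (t : R) : FreeGroup Bool →* Equiv.Perm (R × R) :=
  FreeGroup.lift fun b => if b then shearU t else shearV R

theorem shearU_zpow {R : Type*} [CommRing R] (t : R) (n : ℤ) (v : R × R) :
    ((shearU t) ^ n) v = (v.1 + n * t * v.2, v.2) := by
  induction n using Int.induction_on generalizing v with
  | zero => simp
  | succ i ih =>
    rw [zpow_add_one, Equiv.Perm.mul_apply, ih]
    ext <;> simp [shearU]; ring
  | pred i ih =>
    rw [zpow_sub_one, Equiv.Perm.mul_apply, ih]
    ext <;> simp [shearU, Equiv.Perm.inv_def, Equiv.symm]; ring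

theorem shearV_zpow {R : Type*} [CommRing R] (n : ℤ) (v : R × R) :
    ((shearV R) ^ n) v = (v.1, v.2 + n * v.1) := by
  induction n using Int.induction_on generalizing v with
  | zero => simp
  | succ i ih =>
    rw [zpow_add_one, Equiv.Perm.mul_apply, ih]
    ext <;> simp [shearV]; ring
  | pred i ih =>
    rw [zpow_sub_one, Equiv.Perm.mul_apply, ih]
    ext <;> simp [shearV, Equiv.Perm.inv_def, Equiv.symm]; ring

theorem one_le_norm_int {n : ℤ} (hn : n ≠ 0) : (1 : ℝ) ≤ ‖(n : ℂ)‖ := by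
  rw [Complex.norm_intCast]
  exact_mod_cast Int.one_le_abs hn

open scoped Pointwise in
theorem rho_injective (l : ℂ) (hl : 4 ≤ ‖l‖) : Function.Injective (rho l) := by
  have key : rho l = (Monoid.CoprodI.lift fun i : Bool => FreeGroup.lift fun _ : Unit =>
      (if i then shearU l else shearV ℂ)).comp (freeGroupEquivCoprodI (ι := Bool)).toMonoidHom := by
    ext i : 1
    simp [rho]
  rw [key, MonoidHom.coe_comp]
  refine Function.Injective.comp ?_ (MulEquiv.injective freeGroupEquivCoprodI)
  let S : Bool → Set (ℂ × ℂ) := fun i =>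
    if i then {v | 2 * ‖v.2‖ < ‖v.1‖} else {v | ‖v.1‖ < 2 * ‖v.2‖}
  refine Monoid.CoprodI.lift_injective_of_ping_pong (H := fun _ : Bool => FreeGroup Unit)
    (fun i : Bool => FreeGroup.lift fun _ : Unit => (if i then shearU l else shearV ℂ))
    ?_ S ?_ ?_ ?_
  · right
    refine ⟨true, ?_⟩
    rw [FreeGroup.freeGroupUnitEquivInt.cardinal_eq, Cardinal.mk_denumerable]
    exact Cardinal.natCast_le_aleph0
  · intro i
    cases i
    · exact ⟨(0, 1), by simp [S]⟩
    · exact ⟨(1, 0), by simp [S]⟩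
  · intro i j hij
    rw [Function.onFun, Set.disjoint_left]
    cases i <;> cases j <;> simp [S] at hij ⊢ <;> intro a b h <;> linarith
  · intro i j hij
    refine FreeGroup.freeGroupUnitEquivInt.forall_congr_left.mpr ?_
    intro n hne1
    have hn : n ≠ 0 := by
      rintro rfl
      apply hne1
      simp [FreeGroup.freeGroupUnitEquivInt]
    have e : FreeGroup.freeGroupUnitEquivInt.symm n = FreeGroup.of () ^ n := rfl
    rw [e, map_zpow, FreeGroup.lift_apply_of]
    rintro _ ⟨v, hv, rfl⟩
    have h1 := one_le_norm_int hn
    cases i <;> cases j <;> simp [S] at hij hv ⊢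
    · rw [shearV_zpow]
      have h2 : ‖(n : ℂ) * v.1‖ ≤ ‖v.2 + n * v.1‖ + ‖v.2‖ := by
        have := norm_sub_le (v.2 + n * v.1) v.2
        simpa using this
      rw [norm_mul] at h2
      have h3 := norm_nonneg v.1
      dsimp only
      nlinarith
    · rw [shearU_zpow]
      have h2 : ‖(n : ℂ) * l * v.2‖ ≤ ‖v.1 + n * l * v.2‖ + ‖v.1‖ := by
        have := norm_sub_le (v.1 + n * l * v.2) v.1
        simpa using this
      rw [norm_mul, norm_mul] at h2
      have h3 := norm_nonneg v.2
      have h4 : 4 ≤ ‖(n : ℂ)‖ * ‖l‖ := by nlinarith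
      dsimp only
      nlinarith

theorem rho_map {R S : Type*} [CommRing R] [CommRing S] (f : R →+* S) (t : R)
    (w : FreeGroup Bool) (v : R × R) :
    Prod.map f f (rho t w v) = rho (f t) w (Prod.map f f v) := by
  induction w using FreeGroup.induction_on generalizing v with
  | C1 => simp
  | of b => cases b <;> simp [rho, shearU, shearV]
  | inv_of b ih =>
    rw [map_inv, map_inv, Equiv.Perm.eq_inv_iff_eq, ← ih]
    simp
  | mul x y hx hy => simp only [map_mul, Equiv.Perm.mul_apply, hx, hy]

section ringPart

variable {A : Type*} [Ring A] [Algebra ℂ A]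

/-- The element `P(ab) a + b Q(ab) a`. -/
noncomputable def vec (a b : A) (s : ℂ[X] × ℂ[X]) : A :=
  aeval (a * b) s.1 * a + b * aeval (a * b) s.2 * a

theorem aeval_mul_swap (r s : A) (P : ℂ[X]) :
    aeval (r * s) P * r = r * aeval (s * r) P := by
  induction P using Polynomial.induction_on' with
  | add p q hp hq => simp [add_mul, mul_add, hp, hq]
  | monomial n c =>
    simp only [aeval_monomial]
    have h : (r * s) ^ n * r = r * (s * r) ^ n := by
      induction n with
      | zero => simp
      | succ n ih => rw [pow_succ', mul_assoc, ih, pow_succ']; simp only [mul_assoc]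
    rw [mul_assoc, h, ← mul_assoc, Algebra.commutes, mul_assoc]

theorem lift_mul_vec {a b : A} (ha : a * a = 0) (hb : b * b = 0) (u v : Aˣ)
    (hu : (u : A) = 1 + a) (hv : (v : A) = 1 + b) (w : FreeGroup Bool) (s : ℂ[X] × ℂ[X]) :
    ((FreeGroup.lift (fun b : Bool => if b then u else v) w : Aˣ) : A) * vec a b s
      = vec a b (rho X w s) := by
  have h0 (P : ℂ[X]) : a * (aeval (a * b) P * a) = 0 := by
    rw [aeval_mul_swap, ← mul_assoc, ha, zero_mul]
  induction w using FreeGroup.induction_on generalizing s with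
  | C1 => simp
  | of i =>
    cases i
    · simp only [FreeGroup.lift_apply_of, rho, Bool.false_eq_true, if_false, hv, shearV, vec,
        Equiv.coe_fn_mk, map_add]
      have : b * (b * aeval (a * b) s.2 * a) = 0 := by
        rw [← mul_assoc, ← mul_assoc, hb]; simp
      rw [add_mul, mul_add b, this]
      noncomm_ring
    · simp only [FreeGroup.lift_apply_of, rho, if_true, hu, shearU, vec,
        Equiv.coe_fn_mk, map_add, map_mul, aeval_X]
      rw [add_mul, mul_add a, h0]
      noncomm_ring
  | inv_of i ih =>
    rw [map_inv, map_inv]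
    have := ih ((rho X (FreeGroup.of i))⁻¹ s)
    rw [show rho X (FreeGroup.of i) ((rho X (FreeGroup.of i))⁻¹ s) = s from Equiv.apply_symm_apply _ _] at this
    rw [← this, ← mul_assoc]
    simp
  | mul x y hx hy =>
    rw [map_mul, map_mul, Units.val_mul, mul_assoc, hy, hx, Equiv.Perm.mul_apply]

/-- If a nontrivial word is trivial, every root of the minimal polynomial of `s r`, where
`r s = a b`, has modulus less than `4`. -/
theorem norm_root_lt {a b r s : A} (ha : a * a = 0) (hb : b * b = 0) (hrs : a * b = r * s)
    (u v : Aˣ) (hu : (u : A) = 1 + a) (hv : (v : A) = 1 + b) (w : FreeGroup Bool) (hw : w ≠ 1)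
    (hw1 : FreeGroup.lift (fun b : Bool => if b then u else v) w = 1) (l : ℂ)
    (hl : (minpoly ℂ (s * r)).eval l = 0) : ‖l‖ < 4 := by
  by_contra hlt
  push Not at hlt
  apply hw
  apply rho_injective l hlt
  rw [map_one]
  ext1 c
  have hl0 : l ≠ 0 := by
    rintro rfl
    norm_num at hlt
  have h0 (P : ℂ[X]) : a * (aeval (a * b) P * a) = 0 := by
    rw [aeval_mul_swap, ← mul_assoc, ha, zero_mul]
  have h1 := lift_mul_vec ha hb u v hu hv w (C c.1, C c.2)
  rw [hw1, Units.val_one, one_mul] at h1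
  have hm := rho_map (evalRingHom l) X w (C c.1, C c.2)
  set s' := rho X w (C c.1, C c.2) with hs'
  have fin (F : ℂ[X]) (hF : aeval (a * b) F * (a * b) = 0) : F.eval l = 0 := by
    have h2 : aeval (s * r) (X * (X * F)) = 0 := by
      have e1 : aeval (s * r) (X * F) * s = 0 := by
        rw [aeval_mul_swap, ← hrs, map_mul, aeval_X]
        have : a * b * aeval (a * b) F = aeval (a * b) F * (a * b) := by
          have := congrArg (aeval (a * b)) (mul_comm X F)
          simpa using this
        rw [this, hF, mul_zero]
      have e2 : (X * (X * F) : ℂ[X]) = (X * F) * X := mul_comm _ _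
      rw [e2, map_mul, aeval_X, ← mul_assoc, e1, zero_mul]
    have h3 := minpoly.dvd ℂ _ h2
    have h4 := eval_eq_zero_of_dvd_of_eval_eq_zero h3 hl
    simpa [hl0] using h4
  have hQ : (s'.2 - C c.2).eval l = 0 := by
    have h2 := congrArg (fun y => a * y * b) h1
    simp only [vec, mul_add, h0, zero_add] at h2
    have h5 : aeval (a * b) (X * (s'.2 - C c.2)) * (a * b) = 0 := by
      rw [map_mul, map_sub, aeval_X]
      rw [mul_sub, sub_mul, sub_eq_zero]
      simpa only [mul_assoc] using h2.symm
    simpa [hl0] using fin _ h5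
  have hP : (s'.1 - C c.1).eval l = 0 := by
    have h2 := congrArg (fun y => a * (b * y) * b) h1
    have hb' (y : A) : b * (b * y) = 0 := by rw [← mul_assoc, hb, zero_mul]
    simp only [vec, mul_add, mul_assoc, hb', add_zero] at h2
    have h5 : aeval (a * b) (X * (s'.1 - C c.1)) * (a * b) = 0 := by
      rw [map_mul, map_sub, aeval_X]
      rw [mul_sub, sub_mul, sub_eq_zero]
      simpa only [mul_assoc] using h2.symm
    simpa [hl0] using fin _ h5
  simp only [coe_evalRingHom, eval_X, Prod.map, eval_C] at hm
  rw [show c = (c.1, c.2) from rfl, ← hm]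
  simp only [eval_sub, eval_C, sub_eq_zero] at hP hQ
  simp [hP, hQ]

end ringPart

section analytic

open scoped Classical

/-- The Hilbert space `ℓ²(G)`. -/
noncomputable abbrev l2 (G : Type*) := lp (fun _ : G => ℂ) 2

/-- The operator permuting coordinates. -/
noncomputable def transl {G : Type*} (e : Equiv.Perm G) : l2 G →ₗᵢ[ℂ] l2 G where
  toFun f := ⟨fun g => f (e.symm g), by
    have h := lp.memℓp f
    rw [memℓp_gen_iff (by norm_num)] at h
    refine memℓp_gen ?_
    exact (Equiv.summable_iff e.symm).mpr h⟩
  map_add' f g := by ext; rfl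
  map_smul' c f := by ext; rfl
  norm_map' f := by
    rw [lp.norm_eq_tsum_rpow (by norm_num), lp.norm_eq_tsum_rpow (by norm_num)]
    congr 1
    exact Equiv.tsum_eq e.symm (fun i => ‖f i‖ ^ (ENNReal.toReal 2))

theorem transl_apply {G : Type*} (e : Equiv.Perm G) (f : l2 G) (g : G) :
    (transl e f : l2 G) g = f (e.symm g) := rfl

/-- The basis vector at `g`. -/
noncomputable def dl {G : Type*} (g : G) : l2 G := lp.single 2 g (1 : ℂ)

theorem dl_apply {G : Type*} (g x : G) : (dl g : l2 G) x = if x = g then 1 else 0 := by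
  rw [dl, lp.single_apply]
  by_cases h : x = g
  · subst h; simp
  · simp [h]

theorem inner_dl {G : Type*} (g : G) (f : l2 G) : inner ℂ (dl g) f = f g := by
  rw [dl, lp.inner_single_left]
  simp

theorem transl_dl {G : Type*} (e : Equiv.Perm G) (g : G) : transl e (dl g) = dl (e g) := by
  ext x
  rw [transl_apply, dl_apply, dl_apply]
  simp [Equiv.symm_apply_eq]

variable {G : Type*} [Group G]

/-- Left translations as a monoid homomorphism. -/
noncomputable def lt : G →* (l2 G →L[ℂ] l2 G) where
  toFun g := (transl (Equiv.mulLeft g)).toContinuousLinearMap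
  map_one' := by ext f x; simp [transl_apply, Equiv.Perm.one_def]
  map_mul' a b := by
    ext f x
    have e : (Equiv.mulLeft (a * b)).symm x = (Equiv.mulLeft b).symm ((Equiv.mulLeft a).symm x) := by
      rw [Equiv.symm_apply_eq]
      simp only [Equiv.mulLeft_symm, Equiv.coe_mulLeft]
      group
    change f ((Equiv.mulLeft (a * b)).symm x) = f ((Equiv.mulLeft b).symm ((Equiv.mulLeft a).symm x))
    rw [e]

theorem lt_apply (g : G) (f : l2 G) (x : G) : (lt g f : l2 G) x = f (g⁻¹ * x) := by
  simp [lt, transl_apply]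

theorem lt_dl (g x : G) : lt g (dl x) = dl (g * x) := by
  simp [lt, transl_dl]

/-- Right translation. -/
noncomputable def rt (g : G) : l2 G →ₗᵢ[ℂ] l2 G := transl (Equiv.mulRight g)

theorem rt_apply (g : G) (f : l2 G) (x : G) : (rt g f : l2 G) x = f (x * g⁻¹) := by
  simp [rt, transl_apply]

theorem rt_dl (g x : G) : rt g (dl x) = dl (x * g) := by
  simp [rt, transl_dl]

theorem rt_rt_inv (g : G) (f : l2 G) : rt g (rt g⁻¹ f) = f := by
  ext x
  simp [rt_apply]

/-- The trace. -/
noncomputable def tr (T : l2 G →L[ℂ] l2 G) : ℂ := (T (dl 1) : l2 G) 1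

theorem tr_add (S T : l2 G →L[ℂ] l2 G) : tr (S + T) = tr S + tr T := rfl
theorem tr_sub (S T : l2 G →L[ℂ] l2 G) : tr (S - T) = tr S - tr T := rfl
theorem tr_smul (c : ℂ) (T : l2 G →L[ℂ] l2 G) : tr (c • T) = c * tr T := rfl

theorem tr_lt (g : G) : tr (lt g) = if g = 1 then 1 else 0 := by
  rw [tr, lt_dl, dl_apply]
  simp [eq_comm]

/-- Operators commuting with right translations. -/
def IsR (T : l2 G →L[ℂ] l2 G) : Prop := ∀ g f, T (rt g f) = rt g (T f)

theorem IsR.mul {S T : l2 G →L[ℂ] l2 G} (hS : IsR S) (hT : IsR T) : IsR (S * T) := by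
  intro g f
  simp [hS g, hT g]

theorem IsR.add {S T : l2 G →L[ℂ] l2 G} (hS : IsR S) (hT : IsR T) : IsR (S + T) := by
  intro g f
  simp [hS g, hT g]

theorem IsR.sub {S T : l2 G →L[ℂ] l2 G} (hS : IsR S) (hT : IsR T) : IsR (S - T) := by
  intro g f
  simp [hS g, hT g]

theorem IsR.algebraMap (c : ℂ) : IsR (algebraMap ℂ (l2 G →L[ℂ] l2 G) c) := by
  intro g f
  simp [Algebra.algebraMap_eq_smul_one]

theorem IsR.lt (g : G) : IsR (lt g) := by
  intro x f
  ext y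
  simp [lt_apply, rt_apply, mul_assoc]

theorem IsR.aeval {T : l2 G →L[ℂ] l2 G} (hT : IsR T) (F : ℂ[X]) : IsR (aeval T F) := by
  induction F using Polynomial.induction_on with
  | C a => rw [aeval_C]; exact IsR.algebraMap a
  | add p q hp hq => rw [map_add]; exact hp.add hq
  | monomial n a h =>
    rw [pow_succ, ← mul_assoc, map_mul, aeval_X]
    exact h.mul hT

theorem hasSum_tr {S T : l2 G →L[ℂ] l2 G} (hT : IsR T) :
    HasSum (fun g => (S (dl 1) : l2 G) g * (T (dl 1) : l2 G) g⁻¹) (tr (T * S)) := by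
  have h1 := lp.hasSum_single (p := 2) (by norm_num) (S (dl (1 : G)))
  have h2 := h1.mapL T
  have h3 := h2.mapL (innerSL ℂ (dl (1 : G)))
  simp only [innerSL_apply_apply, inner_dl] at h3
  change HasSum _ ((T (S (dl 1)) : l2 G) 1)
  have hfun : (fun g => (S (dl 1) : l2 G) g * (T (dl 1) : l2 G) g⁻¹) =
      fun g => (T (lp.single 2 g ((S (dl 1) : l2 G) g)) : l2 G) 1 := by
    funext g
    have e : (lp.single 2 g ((S (dl 1) : l2 G) g) : l2 G) = (S (dl 1) : l2 G) g • dl g := by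
      rw [show dl g = lp.single 2 g (1 : ℂ) from rfl, ← lp.single_smul, smul_eq_mul, mul_one]
    rw [e, map_smul]
    have e2 : T (dl g) = rt g (T (dl 1)) := by
      rw [← hT, rt_dl, one_mul]
    rw [e2]
    simp [rt_apply]
  rw [hfun]
  exact h3

theorem tr_mul_comm {S T : l2 G →L[ℂ] l2 G} (hS : IsR S) (hT : IsR T) :
    tr (T * S) = tr (S * T) := by
  have h1 := hasSum_tr (S := S) hT
  have h2 := hasSum_tr (S := T) hS
  rw [← (Equiv.inv G).hasSum_iff] at h2
  refine h1.unique ?_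
  convert h2 using 2 with g
  simp [mul_comm]

theorem isR_starProjection (W : Submodule ℂ (l2 G)) [W.HasOrthogonalProjection]
    (hW : ∀ g, ∀ f ∈ W, rt g f ∈ W) : IsR W.starProjection := by
  intro g f
  apply Submodule.eq_starProjection_of_mem_orthogonal
  · exact hW _ _ (W.starProjection_apply_mem f)
  · rw [← map_sub, Submodule.mem_orthogonal]
    intro w hw
    rw [← rt_rt_inv g w, LinearIsometry.inner_map_map]
    exact (Submodule.mem_orthogonal _ _).1 (W.sub_starProjection_mem_orthogonal f) _ (hW _ _ hw)

theorem tr_starProjection (W : Submodule ℂ (l2 G)) [W.HasOrthogonalProjection] :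
    tr W.starProjection = ((‖W.starProjection (dl 1)‖ ^ 2 : ℝ) : ℂ) := by
  rw [tr, ← inner_dl, ← W.starProjection_eq_self_iff.mpr (W.starProjection_apply_mem (dl 1)),
    ← Submodule.inner_starProjection_left_eq_right,
    W.starProjection_eq_self_iff.mpr (W.starProjection_apply_mem (dl 1)),
    inner_self_eq_norm_sq_to_K]
  simp

theorem step {C : l2 G →L[ℂ] l2 G} (hC : IsR C) (l : ℂ) (ρ : ℝ) (hl : ‖l‖ ≤ ρ)
    (W W' : Submodule ℂ (l2 G)) [W.HasOrthogonalProjection] [W'.HasOrthogonalProjection]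
    (hW : ∀ g, ∀ f ∈ W, rt g f ∈ W) (hW' : ∀ g, ∀ f ∈ W', rt g f ∈ W') (hle : W ≤ W')
    (hCW : ∀ f ∈ W', C f - l • f ∈ W)
    (ih : ‖tr (C * W.starProjection)‖ ≤ ρ * ‖W.starProjection (dl 1)‖ ^ 2) :
    ‖tr (C * W'.starProjection)‖ ≤ ρ * ‖W'.starProjection (dl 1)‖ ^ 2 := by
  set p := W.starProjection with hp
  set p' := W'.starProjection with hp'
  set D := C - algebraMap ℂ (l2 G →L[ℂ] l2 G) l with hD
  have hDR : IsR D := hC.sub (IsR.algebraMap l)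
  have hpR : IsR p := isR_starProjection W hW
  have hpR' : IsR p' := isR_starProjection W' hW'
  have hDf (f) : D f = C f - l • f := by simp [hD, Algebra.algebraMap_eq_smul_one]
  have h1 : D * p' = p * (D * p') := by
    ext1 f
    change D (p' f) = p (D (p' f))
    symm
    rw [hp, Submodule.starProjection_eq_self_iff, hDf]
    exact hCW _ (W'.starProjection_apply_mem f)
  have h2 : p' * p = p := by
    ext1 f
    change p' (p f) = p f
    rw [hp', Submodule.starProjection_eq_self_iff]
    exact hle (W.starProjection_apply_mem f)
  have h2' : p * p' = p := Submodule.starProjection_comp_starProjection_of_le hle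
  have h3 : tr (D * p') = tr (D * p) := by
    rw [h1, tr_mul_comm (hDR.mul hpR') hpR, mul_assoc, h2]
  have h4 (q : l2 G →L[ℂ] l2 G) : tr (D * q) = tr (C * q) - l * tr q := by
    rw [hD, sub_mul, tr_sub, Algebra.algebraMap_eq_smul_one, smul_mul_assoc, one_mul, tr_smul]
  rw [h4, h4, hp, hp', tr_starProjection, tr_starProjection, ← hp, ← hp'] at h3
  have h5 : ‖p (dl 1)‖ ^ 2 ≤ ‖p' (dl 1)‖ ^ 2 := by
    have : p (dl 1) = p (p' (dl 1)) := by
      change _ = (p * p') (dl 1)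
      rw [h2']
    rw [this]
    gcongr
    exact W.norm_starProjection_apply_le _
  have h6 : tr (C * p') = tr (C * p) + l * ((‖p' (dl 1)‖ ^ 2 - ‖p (dl 1)‖ ^ 2 : ℝ) : ℂ) := by
    push_cast at h3 ⊢
    linear_combination h3
  rw [h6]
  refine (norm_add_le _ _).trans ?_
  rw [norm_mul, Complex.norm_real, Real.norm_of_nonneg (by linarith)]
  nlinarith

theorem tr_le {C : l2 G →L[ℂ] l2 G} (hC : IsR C) (ρ : ℝ) (E : Submodule ℂ (l2 G))
    [E.HasOrthogonalProjection] (hEc : IsClosed (E : Set (l2 G)))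
    (hE : ∀ g, ∀ f ∈ E, rt g f ∈ E) (hCE : ∀ f, C f ∈ E)
    (m : Multiset ℂ) (hm : ∀ l ∈ m, ‖l‖ ≤ ρ)
    (h0 : aeval C (m.map fun l => X - Polynomial.C l).prod = 0) :
    ‖tr C‖ ≤ ρ * ‖E.starProjection (dl 1)‖ ^ 2 := by
  let W : ℂ[X] → Submodule ℂ (l2 G) := fun F => E ⊓ LinearMap.ker (aeval C F).toLinearMap
  have memW (F f) : f ∈ W F ↔ f ∈ E ∧ aeval C F f = 0 := Iff.rfl
  have hWp (F) : (W F).HasOrthogonalProjection := by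
    have hc : IsClosed (W F : Set (l2 G)) := by
      have e : (W F : Set (l2 G)) = (E : Set (l2 G)) ∩ {f | aeval C F f = 0} := rfl
      rw [e]
      exact hEc.inter (isClosed_eq (aeval C F).continuous continuous_const)
    have := hc.completeSpace_coe
    infer_instance
  have hWR (F) : ∀ g, ∀ f ∈ W F, rt g f ∈ W F := by
    intro g f hf
    rw [memW] at hf ⊢
    refine ⟨hE g f hf.1, ?_⟩
    rw [hC.aeval F, hf.2, map_zero]
  have main : ∀ m : Multiset ℂ, (∀ l ∈ m, ‖l‖ ≤ ρ) →
      ‖tr (C * (W (m.map fun l => X - Polynomial.C l).prod).starProjection)‖ ≤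
        ρ * ‖(W (m.map fun l => X - Polynomial.C l).prod).starProjection (dl 1)‖ ^ 2 := by
    intro m
    induction m using Multiset.induction_on with
    | empty =>
      intro _
      have hz (f) : (W ((0 : Multiset ℂ).map fun l => X - Polynomial.C l).prod).starProjection f
          = 0 := by
        have := (W ((0 : Multiset ℂ).map fun l => X - Polynomial.C l).prod).starProjection_apply_mem f
        rw [memW] at this
        simpa using this.2
      have : C * (W ((0 : Multiset ℂ).map fun l => X - Polynomial.C l).prod).starProjection = 0 := by
        ext1 f
        change C ((W _).starProjection f) = 0
        rw [hz, map_zero]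
      rw [this, hz]
      simp [tr]
    | cons l m ih =>
      intro hl
      refine step hC l ρ (hl l (by simp)) _ _ (hWR _) (hWR _) ?_ ?_
        (ih fun l' hl' => hl l' (by simp [hl']))
      · intro f hf
        rw [memW] at hf ⊢
        refine ⟨hf.1, ?_⟩
        rw [Multiset.map_cons, Multiset.prod_cons, map_mul]
        exact (congrArg (aeval C (X - Polynomial.C l)) hf.2).trans (map_zero _)
      · intro f hf
        rw [memW] at hf ⊢
        refine ⟨E.sub_mem (hCE f) (E.smul_mem _ hf.1), ?_⟩
        have h1 := hf.2
        rw [Multiset.map_cons, Multiset.prod_cons, mul_comm, map_mul] at h1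
        have h2 : aeval C (X - Polynomial.C l) f = C f - l • f := by
          simp [Algebra.algebraMap_eq_smul_one]
        rw [← h2]
        exact h1
  have h1 := main m hm
  have hWE : W (m.map fun l => X - Polynomial.C l).prod = E := by
    ext f
    rw [memW, h0]
    simp
  have h2 : ‖tr (C * E.starProjection)‖ ≤ ρ * ‖E.starProjection (dl 1)‖ ^ 2 := by
    have aux : ∀ (V : Submodule ℂ (l2 G)) [V.HasOrthogonalProjection], V = E →
        ‖tr (C * V.starProjection)‖ ≤ ρ * ‖V.starProjection (dl 1)‖ ^ 2 →
        ‖tr (C * E.starProjection)‖ ≤ ρ * ‖E.starProjection (dl 1)‖ ^ 2 := by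
      intro V _ hV hh
      subst hV
      exact hh
    exact aux _ hWE h1
  rw [tr_mul_comm (isR_starProjection E hE) hC] at h2
  have h3 : E.starProjection * C = C := by
    ext1 f
    change E.starProjection (C f) = C f
    rw [Submodule.starProjection_eq_self_iff]
    exact hCE f
  rwa [h3] at h2

/-- Vectors fixed by the left translations by `K`. -/
noncomputable def fixedBy (K : Subgroup G) : Submodule ℂ (l2 G) where
  carrier := {f | ∀ k ∈ K, lt k f = f}
  add_mem' ha hb k hk := by rw [map_add, ha k hk, hb k hk]
  zero_mem' k _ := map_zero _
  smul_mem' c f hf k hk := by rw [map_smul, hf k hk]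

theorem fixedBy_closed (K : Subgroup G) : IsClosed (fixedBy K : Set (l2 G)) := by
  have e : (fixedBy K : Set (l2 G)) = ⋂ k ∈ K, {f | lt k f = f} := by
    ext f; simp [fixedBy]
  rw [e]
  exact isClosed_biInter fun k _ => isClosed_eq (lt k).continuous continuous_id

theorem card_mul_le (K : Subgroup G) [Fintype K] [(fixedBy K).HasOrthogonalProjection] :
    (Fintype.card K : ℝ) * ‖(fixedBy K).starProjection (dl 1)‖ ^ 2 ≤ 1 := by
  have h1 := tr_starProjection (fixedBy K)
  set f := (fixedBy K).starProjection (dl 1) with hf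
  have hfm : f ∈ fixedBy K := (fixedBy K).starProjection_apply_mem _
  have hfk (k : K) : f k = f 1 := by
    have := hfm k k.2
    rw [← this, lt_apply]
    simp [this]
  have h2 : f 1 = ((‖f‖ ^ 2 : ℝ) : ℂ) := h1
  have h3 := lp.sum_rpow_le_norm_rpow (p := 2) (by norm_num) f
    (Finset.univ.map ⟨((↑) : K → G), Subtype.val_injective⟩)
  simp only [Finset.sum_map, Function.Embedding.coeFn_mk, hfk, h2, ENNReal.toReal_ofNat,
    Real.rpow_two, Complex.norm_real, Finset.sum_const, Finset.card_univ, nsmul_eq_mul,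
    Real.norm_eq_abs, sq_abs] at h3
  rcases (sq_nonneg ‖f‖).eq_or_lt with h | h
  · rw [← h]; simp
  · by_contra hc
    push Not at hc
    nlinarith

end analytic

section final

open scoped Classical

variable {G : Type*} [Group G]

/-- The left regular representation of the integral group ring on `ℓ²(G)`. -/
noncomputable def Phi : MonoidAlgebra ℤ G →ₐ[ℤ] (l2 G →L[ℂ] l2 G) :=
  MonoidAlgebra.lift ℤ (l2 G →L[ℂ] l2 G) G lt

theorem Phi_of (g : G) : Phi (MonoidAlgebra.of ℤ G g) = lt g := MonoidAlgebra.lift_of _ _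

theorem isR_Phi (c : MonoidAlgebra ℤ G) : IsR (Phi c) := by
  induction c using MonoidAlgebra.induction_on with
  | of g => rw [Phi_of]; exact IsR.lt g
  | add p q hp hq => rw [map_add]; exact hp.add hq
  | smul n c h =>
    intro g f
    rw [map_zsmul]
    simp [h g f]

/-- The trace on the group ring. -/
noncomputable def trH : MonoidAlgebra ℤ G →+ ℝ where
  toFun c := (tr (Phi c)).re
  map_zero' := by simp [tr]
  map_add' c d := by simp [tr_add]

theorem trH_of (g : G) : trH (MonoidAlgebra.of ℤ G g) = if g = 1 then 1 else 0 := by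
  change (tr (Phi (MonoidAlgebra.of ℤ G g))).re = _
  rw [Phi_of, tr_lt]
  split_ifs <;> simp

theorem sum_mul_of (K : Subgroup G) [Fintype K] (k : G) (hk : k ∈ K) :
    (∑ g : K, MonoidAlgebra.of ℤ G (g : G)) * MonoidAlgebra.of ℤ G k =
      ∑ g : K, MonoidAlgebra.of ℤ G (g : G) := by
  rw [Finset.sum_mul]
  refine Fintype.sum_equiv (Equiv.mulRight (⟨k, hk⟩ : K)) _ _ ?_
  intro g
  rw [← map_mul]
  rfl

theorem of_mul_sum (K : Subgroup G) [Fintype K] (k : G) (hk : k ∈ K) :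
    MonoidAlgebra.of ℤ G k * (∑ g : K, MonoidAlgebra.of ℤ G (g : G)) =
      ∑ g : K, MonoidAlgebra.of ℤ G (g : G) := by
  rw [Finset.mul_sum]
  refine Fintype.sum_equiv (Equiv.mulLeft (⟨k, hk⟩ : K)) _ _ ?_
  intro g
  rw [← map_mul]
  rfl

theorem card_le_trH (H K : Subgroup G) [Fintype H] [Fintype K] (hHK : H ≤ K) (z y : G)
    (hz : z ∉ K) (hy : y ∉ K) :
    (Fintype.card H : ℝ) ≤ trH ((∑ g : K, MonoidAlgebra.of ℤ G (g : G)) *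
      (1 - MonoidAlgebra.of ℤ G z) * (∑ g : H, MonoidAlgebra.of ℤ G (g : G)) *
      (1 - MonoidAlgebra.of ℤ G y)) := by
  have e : (∑ g : K, MonoidAlgebra.of ℤ G (g : G)) *
      (1 - MonoidAlgebra.of ℤ G z) * (∑ g : H, MonoidAlgebra.of ℤ G (g : G)) *
      (1 - MonoidAlgebra.of ℤ G y) = ∑ i : H, ∑ j : K,
        (MonoidAlgebra.of ℤ G ((j : G) * i) - MonoidAlgebra.of ℤ G ((j : G) * z * i)
          - MonoidAlgebra.of ℤ G ((j : G) * i * y)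
          + MonoidAlgebra.of ℤ G ((j : G) * z * i * y)) := by
    rw [Finset.sum_mul, Finset.sum_mul_sum, Finset.sum_comm, Finset.sum_mul]
    refine Finset.sum_congr rfl fun i _ => ?_
    rw [Finset.sum_mul]
    refine Finset.sum_congr rfl fun j _ => ?_
    simp only [map_mul]
    noncomm_ring
  rw [e, map_sum]
  have hterm : ∀ i : H, (1 : ℝ) ≤ trH (∑ j : K,
        (MonoidAlgebra.of ℤ G ((j : G) * i) - MonoidAlgebra.of ℤ G ((j : G) * z * i)
          - MonoidAlgebra.of ℤ G ((j : G) * i * y)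
          + MonoidAlgebra.of ℤ G ((j : G) * z * i * y))) := by
    intro i
    rw [map_sum]
    have hiK : (i : G) ∈ K := hHK i.2
    have h1 : (1 : ℝ) = ∑ j : K, if j = (⟨i, hiK⟩ : K)⁻¹ then 1 else 0 := by simp
    rw [h1]
    refine Finset.sum_le_sum fun j _ => ?_
    simp only [map_add, map_sub, trH_of]
    have n1 : (j : G) * z * i ≠ 1 := by
      intro hc
      apply hz
      have : z = (j : G)⁻¹ * (i : G)⁻¹ := by
        rw [eq_inv_mul_iff_mul_eq, eq_inv_iff_mul_eq_one]; exact hc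
      rw [this]
      exact K.mul_mem (K.inv_mem j.2) (K.inv_mem hiK)
    have n2 : (j : G) * i * y ≠ 1 := by
      intro hc
      apply hy
      have : y = ((j : G) * i)⁻¹ := by
        exact eq_inv_of_mul_eq_one_right hc
      rw [this]
      exact K.inv_mem (K.mul_mem j.2 hiK)
    have n3 : ((j : G) * i = 1) ↔ j = (⟨i, hiK⟩ : K)⁻¹ := by
      rw [mul_eq_one_iff_eq_inv, Subtype.ext_iff]
      rfl
    rw [if_neg n1, if_neg n2]
    simp only [n3]
    split_ifs <;> norm_num
  calc (Fintype.card H : ℝ) = ∑ i : H, (1 : ℝ) := by simp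
    _ ≤ _ := Finset.sum_le_sum fun i _ => hterm i

theorem exists_rho (m : Multiset ℂ) (hm : ∀ l ∈ m, ‖l‖ < 4) :
    ∃ ρ : ℝ, 0 ≤ ρ ∧ ρ < 4 ∧ ∀ l ∈ m, ‖l‖ ≤ ρ := by
  induction m using Multiset.induction_on with
  | empty => exact ⟨0, le_refl _, by norm_num, by simp⟩
  | cons l m ih =>
    obtain ⟨ρ, h0, h4, h⟩ := ih fun l' hl' => hm l' (by simp [hl'])
    refine ⟨max ρ ‖l‖, le_max_of_le_left h0, max_lt h4 (hm l (by simp)), ?_⟩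
    intro l' hl'
    rcases Multiset.mem_cons.1 hl' with rfl | hl'
    · exact le_max_right _ _
    · exact le_max_of_le_left (h l' hl')

theorem two_le_card (K : Subgroup G) [Fintype K] (k : G) (hk : k ∈ K) (h1 : k ≠ 1) :
    (2 : ℝ) ≤ Fintype.card K := by
  have : 1 < Fintype.card K := Fintype.one_lt_card_iff.2
    ⟨⟨k, hk⟩, 1, fun h => h1 (congrArg Subtype.val h)⟩
  exact_mod_cast this

end final

end BetaFree

open BetaFree Polynomial in
/-- **Proposition 4.2(2).** Let `H ≤ K` be finite subgroups of a group `G`, and let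
`x ∈ G`, `h ∈ H`, `k ∈ K` with `x⁻¹hx ∉ K`. If `xkx⁻¹ ∉ K`, then the generalized
bicyclic units `β_{x,h,H} = 1 + (1−h)·x·H̄` and
`β_{x⁻¹,xkx⁻¹,xKx⁻¹} = 1 + (1−xkx⁻¹)·x⁻¹·(xKx⁻¹)‾` form a free pair in the unit group
of `ℤG`, where `(xKx⁻¹)‾ = ∑_{g ∈ K} x·g·x⁻¹`. -/
theorem beta_beta_free_pair (G : Type*) [Group G] (H K : Subgroup G)
    [Fintype H] [Fintype K] (hHK : H ≤ K) (x h k : G) (hh : h ∈ H) (hk : k ∈ K)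
    (hconj_h : x⁻¹ * h * x ∉ K) (hconj_k : x * k * x⁻¹ ∉ K)
    (u v : (MonoidAlgebra ℤ G)ˣ)
    (hu : (u : MonoidAlgebra ℤ G) =
      1 + (1 - MonoidAlgebra.of ℤ G h) * MonoidAlgebra.of ℤ G x *
        ∑ g : H, MonoidAlgebra.of ℤ G (g : G))
    (hv : (v : MonoidAlgebra ℤ G) =
      1 + (1 - MonoidAlgebra.of ℤ G (x * k * x⁻¹)) * MonoidAlgebra.of ℤ G x⁻¹ *
        ∑ g : K, MonoidAlgebra.of ℤ G (x * (g : G) * x⁻¹)) :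
    IsFreePair u v := by
  unfold IsFreePair
  rw [injective_iff_map_eq_one]
  intro w hw
  by_contra hw1
  have hH1 := sum_mul_of H h hh
  have hK1 := sum_mul_of K k hk
  have hKl := of_mul_sum K
  have htr := card_le_trH H K hHK (x⁻¹ * h * x) (x * k * x⁻¹) hconj_h hconj_k
  have hKx : MonoidAlgebra.of ℤ G x⁻¹ * ∑ g : K, MonoidAlgebra.of ℤ G (x * (g : G) * x⁻¹) =
      (∑ g : K, MonoidAlgebra.of ℤ G (g : G)) * MonoidAlgebra.of ℤ G x⁻¹ := by
    rw [Finset.mul_sum, Finset.sum_mul]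
    refine Finset.sum_congr rfl fun g _ => ?_
    rw [← map_mul, ← map_mul]
    congr 1
    group
  rw [mul_assoc, hKx] at hv
  set Hb := ∑ g : H, MonoidAlgebra.of ℤ G (g : G) with hHb
  set Kb := ∑ g : K, MonoidAlgebra.of ℤ G (g : G) with hKb
  set X0 := MonoidAlgebra.of ℤ G x with hX0
  set X1 := MonoidAlgebra.of ℤ G x⁻¹ with hX1
  set h0 := MonoidAlgebra.of ℤ G h with hh0
  set k0 := MonoidAlgebra.of ℤ G k with hk0
  have hXX : X1 * X0 = 1 := by rw [hX1, hX0, ← map_mul, inv_mul_cancel, map_one]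
  set y0 := MonoidAlgebra.of ℤ G (x * k * x⁻¹) with hy0
  have hy : X1 * y0 = k0 * X1 := by
    rw [hX1, hy0, hk0, ← map_mul, ← map_mul]
    congr 1
    group
  have hz : MonoidAlgebra.of ℤ G (x⁻¹ * h * x) = X1 * h0 * X0 := by
    simp only [hX1, hh0, hX0, map_mul]
  set a0 := (1 - h0) * X0 * Hb with ha0
  set b0 := (1 - y0) * (Kb * X1) with hb0
  have haa : a0 * a0 = 0 := by
    have : a0 * a0 = (1 - h0) * X0 * (Hb - Hb * h0) * (X0 * Hb) := by
      rw [ha0]; noncomm_ring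
    rw [this, hH1, sub_self, mul_zero, zero_mul]
  have hbb : b0 * b0 = 0 := by
    have : b0 * b0 = (1 - y0) * (Kb * (X1 - X1 * y0)) * (Kb * X1) := by
      rw [hb0]; noncomm_ring
    have e2 : Kb * (X1 - X1 * y0) = (Kb - Kb * k0) * X1 := by
      rw [hy]; noncomm_ring
    rw [this, e2, hK1, sub_self, zero_mul, mul_zero, zero_mul]
  set r0 := (1 - h0) * X0 * Hb * (1 - y0) with hr0
  set s0 := Kb * X1 with hs0
  have hab : a0 * b0 = r0 * s0 := by
    rw [ha0, hb0, hr0, ← mul_assoc]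
  have hsr : Kb * (1 - MonoidAlgebra.of ℤ G (x⁻¹ * h * x)) * Hb * (1 - y0) = s0 * r0 := by
    have e : (1 : MonoidAlgebra ℤ G) - X1 * h0 * X0 = X1 * (1 - h0) * X0 := by
      rw [mul_sub, sub_mul, mul_one, hXX]
    rw [hz, e, hs0, hr0]
    simp only [mul_assoc]
  rw [hsr] at htr
  let Pm : MonoidAlgebra ℤ G →* (l2 G →L[ℂ] l2 G) := (Phi : MonoidAlgebra ℤ G →ₐ[ℤ] _)
  have hroot : ∀ l : ℂ, (minpoly ℂ (Phi s0 * Phi r0)).eval l = 0 → ‖l‖ < 4 := by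
    refine norm_root_lt (a := Phi a0) (b := Phi b0) (r := Phi r0) (s := Phi s0)
      (by rw [← map_mul, haa, map_zero]) (by rw [← map_mul, hbb, map_zero])
      (by rw [← map_mul, hab, map_mul]) (Units.map Pm u) (Units.map Pm v) ?_ ?_ w hw1 ?_
    · change Phi (u : MonoidAlgebra ℤ G) = _
      rw [hu, map_add, map_one]
    · change Phi (v : MonoidAlgebra ℤ G) = _
      rw [hv, map_add, map_one]
    · have : (FreeGroup.lift fun b : Bool => if b then Units.map Pm u else Units.map Pm v) =
          (Units.map Pm).comp (FreeGroup.lift fun b : Bool => if b then u else v) := by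
        ext b : 1
        cases b <;> simp
      rw [this, MonoidHom.comp_apply, hw, map_one]
  set C := Phi s0 * Phi r0 with hC
  have hCe : C = Phi (s0 * r0) := (map_mul _ _ _).symm
  have hinteg : IsIntegral ℂ C := by
    by_contra hni
    have := hroot 4 (by rw [minpoly.eq_zero hni]; simp)
    norm_num at this
  obtain ⟨ρ, hρ0, hρ4, hρ⟩ := exists_rho (minpoly ℂ C).roots fun l hl =>
    hroot l ((mem_roots (minpoly.ne_zero hinteg)).1 hl)
  have hcomp := (fixedBy_closed K).completeSpace_coe
  have hmin : aeval C ((minpoly ℂ C).roots.map fun l => X - Polynomial.C l).prod = 0 := by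
    rw [← (IsAlgClosed.splits (minpoly ℂ C)).eq_prod_roots_of_monic (minpoly.monic hinteg)]
    exact minpoly.aeval _ _
  have hfin := tr_le (C := C) (by rw [hCe]; exact isR_Phi _) ρ (fixedBy K) (fixedBy_closed K)
    (by
      intro g f hf k hk
      rw [IsR.lt k, hf k hk])
    (by
      intro f k hk
      have e : lt k * C = C := by
        rw [← Phi_of, hCe, ← map_mul, ← mul_assoc _ s0, hs0, ← mul_assoc _ Kb, hKl k hk]
      exact congrArg (fun T : l2 G →L[ℂ] l2 G => T f) e)
    _ hρ hmin
  have hcard := card_mul_le K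
  have h2H : (2 : ℝ) ≤ Fintype.card H := two_le_card H h hh (by
    rintro rfl
    exact hconj_h (by simp [K.one_mem]))
  have h2K : (2 : ℝ) ≤ Fintype.card K := two_le_card K k hk (by
    rintro rfl
    exact hconj_k (by simp [K.one_mem]))
  have h3 : (Fintype.card H : ℝ) ≤ ‖tr C‖ := by
    refine htr.trans ?_
    change (tr (Phi (s0 * r0))).re ≤ _
    rw [← hCe]
    exact Complex.re_le_norm _
  have h4 := h3.trans hfin
  set q := ‖(fixedBy K).starProjection (dl 1)‖ ^ 2
  have hq : 0 ≤ q := sq_nonneg _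
  have h5 : (2 : ℝ) * 2 ≤ Fintype.card H * Fintype.card K := by gcongr
  have h6 : (Fintype.card H : ℝ) * Fintype.card K ≤ ρ * q * Fintype.card K := by gcongr
  have h7 : ρ * q * Fintype.card K ≤ ρ := by nlinarith
  linarith
end

section
/- Let S₃ be the symmetric group on three letters. Then M(S₃) = 2; that is: (i) for every pair of bicyclic units α = 1+a, β = 1+b of ℤS₃ such that a·b is not nilpotent, the pair (α, β²) is a free pair; and (ii) there exist bicyclic units α = 1+a, β = 1+b of ℤS₃ such that a·b is not nilpotent but (α, β) is not a free pair (for example α = γ_{σ,τ} and β = β_{σ²,στ} with σ = (1,2,3) and τ = (1,2)). -/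
/-- `ĥ = 1 + h + h² + ⋯ + h^{d-1}` in `ℤG`, where `d` is the order of `h`. -/
noncomputable def hat {G : Type*} [Group G] (h : G) : MonoidAlgebra ℤ G :=
  ∑ i ∈ Finset.range (orderOf h), (MonoidAlgebra.of ℤ G h) ^ i

/-- The bicyclic unit `β_{x,h} = 1 + (1 − h)·x·ĥ` of `ℤG`. -/
noncomputable def bicyclicBeta {G : Type*} [Group G] (x h : G) : MonoidAlgebra ℤ G :=
  1 + (1 - MonoidAlgebra.of ℤ G h) * MonoidAlgebra.of ℤ G x * hat h

/-- The bicyclic unit `γ_{x,h} = 1 + ĥ·x·(1 − h)` of `ℤG`. -/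
noncomputable def bicyclicGamma {G : Type*} [Group G] (x h : G) : MonoidAlgebra ℤ G :=
  1 + hat h * MonoidAlgebra.of ℤ G x * (1 - MonoidAlgebra.of ℤ G h)

/-- `u ∈ ℤG` is a bicyclic unit (of either type). -/
def IsBicyclicUnit {G : Type*} [Group G] (u : MonoidAlgebra ℤ G) : Prop :=
  ∃ x h : G, u = bicyclicBeta x h ∨ u = bicyclicGamma x h

/-- The symmetric group on three letters. -/
abbrev S3 := Equiv.Perm (Fin 3)

open scoped Pointwise in
/-- General ping-pong for two generators, in terms of powers. -/
theorem freePair_of_pingpong {G : Type*} [Group G] (u v : G) {Z : Type*} [MulAction G Z]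
    (X Y : Set Z) (hX : X.Nonempty) (hY : Y.Nonempty) (hXY : Disjoint X Y)
    (hu : ∀ n : ℤ, n ≠ 0 → ∀ z ∈ Y, u ^ n • z ∈ X)
    (hv : ∀ n : ℤ, n ≠ 0 → ∀ z ∈ X, v ^ n • z ∈ Y) : IsFreePair u v := by
  unfold IsFreePair
  set a : Bool → G := fun b : Bool => if b then u else v with ha
  have : FreeGroup.lift a =
      (Monoid.CoprodI.lift fun i => FreeGroup.lift fun _ => a i).comp
        (@freeGroupEquivCoprodI Bool).toMonoidHom := by
    ext i
    simp
  rw [this, MonoidHom.coe_comp]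
  refine Function.Injective.comp ?_ (MulEquiv.injective freeGroupEquivCoprodI)
  let H : Bool → Type _ := fun _i => FreeGroup Unit
  let f : ∀ i, H i →* G := fun i => FreeGroup.lift fun _ => a i
  let X' : Bool → Set Z := fun i => if i then X else Y
  refine Monoid.CoprodI.lift_injective_of_ping_pong f ?_ X' ?_ ?_ ?_
  · right
    refine ⟨true, ?_⟩
    simp only [H]
    rw [FreeGroup.freeGroupUnitEquivInt.cardinal_eq, Cardinal.mk_denumerable]
    exact Cardinal.natCast_le_aleph0
  · intro i
    cases i
    · exact hY
    · exact hX
  · intro i j hij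
    cases i <;> cases j
    · exact absurd rfl hij
    · exact hXY.symm
    · exact hXY
    · exact absurd rfl hij
  · intro i j hij
    refine FreeGroup.freeGroupUnitEquivInt.forall_congr_left.mpr ?_
    intro n hne1
    change FreeGroup.lift (fun _ => a i) (FreeGroup.of () ^ n) • X' j ⊆ X' i
    simp only [map_zpow, FreeGroup.lift_apply_of]
    have hnne0 : n ≠ 0 := by
      rintro rfl
      apply hne1
      simp [H, FreeGroup.freeGroupUnitEquivInt]
    rintro _ ⟨z, hz, rfl⟩
    cases i <;> cases j
    · exact absurd rfl hij
    · exact hv n hnne0 z hz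
    · exact hu n hnne0 z hz
    · exact absurd rfl hij

theorem coe_zpow_of_sq_zero {R : Type*} [Ring R] (u : Rˣ) (a : R) (hu : (u : R) = 1 + a)
    (ha : a * a = 0) (n : ℤ) : ((u ^ n : Rˣ) : R) = 1 + n • a := by
  have hinv : ((u⁻¹ : Rˣ) : R) = 1 - a := by
    apply Units.inv_eq_of_mul_eq_one_right
    rw [hu, add_mul, mul_sub, mul_sub, ha]
    simp
  induction n using Int.induction_on with
  | zero => simp
  | succ i ih =>
    rw [zpow_add_one, Units.val_mul, ih, hu, add_mul, mul_add, mul_add, smul_mul_assoc,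
      smul_mul_assoc, ha, add_smul]
    simp
    abel
  | pred i ih =>
    rw [zpow_sub_one, Units.val_mul, ih, hinv, add_mul, mul_sub, mul_sub, smul_mul_assoc,
      smul_mul_assoc, ha, sub_smul]
    simp
    abel

theorem freePair_of_trace {R : Type*} [Ring R]
    (htf : ∀ (n : ℤ) (r : R), n • r = 0 → n = 0 ∨ r = 0)
    (u v : Rˣ) (a b : R) (hu : (u : R) = 1 + a) (hv : (v : R) = 1 + b)
    (ha : a * a = 0) (hb : b * b = 0) (s : ℤ) (hs : 2 ≤ |s|) (hab : a * b * a = s • a)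
    (ha0 : a ≠ 0) : IsFreePair u (v ^ 2) := by
  have hs0 : s ≠ 0 := by
    rintro rfl
    norm_num at hs
  have hindep : ∀ x y x' y' : ℤ, x • a + y • (b * a) = x' • a + y' • (b * a) →
      x = x' ∧ y = y' := by
    intro x y x' y' h
    have h0 : (x - x') • a + (y - y') • (b * a) = 0 := by
      rw [← sub_eq_zero] at h
      rw [← h]
      module
    have h1 : ((y - y') * s) • a = 0 := by
      have := congrArg (fun r => a * r) h0
      simp only [mul_add, mul_smul_comm, ha, mul_zero, smul_zero, zero_add, ← mul_assoc, hab]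
        at this
      rwa [mul_smul]
    have hy : y - y' = 0 := by
      rcases htf _ _ h1 with h | h
      · exact (mul_eq_zero.mp h).resolve_right hs0
      · exact absurd h ha0
    rw [hy, zero_smul, add_zero] at h0
    have hx : x - x' = 0 := (htf _ _ h0).resolve_right ha0
    constructor <;> linarith
  refine freePair_of_pingpong u (v ^ 2) (Z := R)
    {r | ∃ x y : ℤ, |y| < |x| ∧ r = x • a + y • (b * a)}
    {r | ∃ x y : ℤ, |x| < |y| ∧ r = x • a + y • (b * a)} ?_ ?_ ?_ ?_ ?_
  · exact ⟨_, 1, 0, by norm_num, rfl⟩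
  · exact ⟨_, 0, 1, by norm_num, rfl⟩
  · rw [Set.disjoint_left]
    rintro r ⟨x, y, hxy, rfl⟩ ⟨x', y', hxy', h⟩
    obtain ⟨rfl, rfl⟩ := hindep _ _ _ _ h
    exact absurd hxy (not_lt.mpr hxy'.le)
  · rintro n hn r ⟨x, y, hxy, rfl⟩
    refine ⟨x + n * s * y, y, ?_, ?_⟩
    · have h1 : 1 ≤ |n| := Int.one_le_abs hn
      have h2 : |n * s * y| ≤ |x + n * s * y| + |x| := by
        have := abs_sub (x + n * s * y) x
        simpa using this
      rw [abs_mul, abs_mul] at h2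
      have h3 : 2 ≤ |n| * |s| := by nlinarith
      nlinarith [abs_nonneg y]
    · rw [Units.smul_def, coe_zpow_of_sq_zero u a hu ha, smul_eq_mul, add_mul, one_mul, mul_add,
        smul_mul_smul_comm, smul_mul_smul_comm, ha, ← mul_assoc, hab]
      module
  · rintro n hn r ⟨x, y, hxy, rfl⟩
    refine ⟨x, y + 2 * n * x, ?_, ?_⟩
    · have h1 : 1 ≤ |n| := Int.one_le_abs hn
      have h2 : |2 * n * x| ≤ |y + 2 * n * x| + |y| := by
        have := abs_sub (y + 2 * n * x) y
        simpa using this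
      rw [abs_mul, abs_mul, abs_two] at h2
      nlinarith [abs_nonneg x]
    · have h2 : ((v ^ 2) ^ n : Rˣ) = v ^ (2 * n) := by
        rw [zpow_mul]; rfl
      rw [h2, Units.smul_def, coe_zpow_of_sq_zero v b hv hb, smul_eq_mul, add_mul, one_mul,
        mul_add, smul_mul_smul_comm, smul_mul_smul_comm, ← mul_assoc, hb, zero_mul]
      module

/-- Enumeration of `S₃`. -/
def e6 : Fin 6 → S3 :=
  let σ : S3 := finRotate 3
  let τ : S3 := Equiv.swap 0 1
  ![1, σ, σ * σ, τ, σ * τ, σ * σ * τ]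

/-- Multiplication table of `S₃`. -/
def m6 : Fin 6 → Fin 6 → Fin 6 :=
  ![![0, 1, 2, 3, 4, 5], ![1, 2, 0, 4, 5, 3], ![2, 0, 1, 5, 3, 4],
    ![3, 5, 4, 0, 2, 1], ![4, 3, 5, 1, 0, 2], ![5, 4, 3, 2, 1, 0]]

theorem e6_mul : ∀ i j, e6 i * e6 j = e6 (m6 i j) := by decide

theorem e6_surj : ∀ g, ∃ i, e6 i = g := by decide

theorem e6_inj : ∀ i j, e6 i = e6 j → i = j := by decide

/-- Element of `ℤS₃` with given coefficients. -/
noncomputable def E6 (f : Fin 6 → ℤ) : MonoidAlgebra ℤ S3 :=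
  ∑ i, f i • MonoidAlgebra.of ℤ S3 (e6 i)

/-- Convolution. -/
def conv6 (f g : Fin 6 → ℤ) : Fin 6 → ℤ :=
  fun k => ∑ i, ∑ j, if m6 i j = k then f i * g j else 0

theorem E6_mul (f g : Fin 6 → ℤ) : E6 f * E6 g = E6 (conv6 f g) := by
  unfold E6 conv6
  rw [Finset.sum_mul_sum]
  simp only [Finset.sum_smul, smul_mul_smul_comm, ← map_mul, e6_mul]
  symm
  rw [Finset.sum_comm]
  refine Finset.sum_congr rfl fun i _ => ?_
  rw [Finset.sum_comm]
  refine Finset.sum_congr rfl fun j _ => ?_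
  simp [ite_smul]

theorem E6_add (f g : Fin 6 → ℤ) : E6 f + E6 g = E6 (f + g) := by
  simp [E6, add_smul, Finset.sum_add_distrib]

theorem E6_sub (f g : Fin 6 → ℤ) : E6 f - E6 g = E6 (f - g) := by
  simp [E6, sub_smul, Finset.sum_sub_distrib]

theorem E6_smul (n : ℤ) (f : Fin 6 → ℤ) : n • E6 f = E6 (n • f) := by
  simp [E6, mul_smul, Finset.smul_sum]

theorem E6_zero : E6 0 = 0 := by simp [E6]

theorem E6_of (i : Fin 6) : MonoidAlgebra.of ℤ S3 (e6 i) = E6 (Pi.single i 1) := by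
  simp [E6, Pi.single_apply, ite_smul]

theorem E6_one : (1 : MonoidAlgebra ℤ S3) = E6 (Pi.single 0 1) := by
  rw [← E6_of]
  exact (map_one _).symm

theorem E6_coeff (f : Fin 6 → ℤ) (k : Fin 6) : (E6 f).coeff (e6 k) = f k := by
  have h : ∀ i, (e6 i = e6 k) = (i = k) := fun i =>
    propext ⟨e6_inj i k, fun h => h ▸ rfl⟩
  simp [E6, MonoidAlgebra.coeff_sum, Finsupp.finsetSum_apply, Finsupp.single_apply, h]

theorem ZS3_torsionFree (n : ℤ) (r : MonoidAlgebra ℤ S3) (h : n • r = 0) : n = 0 ∨ r = 0 := by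
  by_cases hn : n = 0
  · exact Or.inl hn
  · right
    ext g
    have := congrArg (fun r => r.coeff g) h
    simp only [MonoidAlgebra.coeff_smul, Finsupp.smul_apply] at this
    simpa [hn] using this

/-- The coefficients of `ĥ`. -/
def hat6 : Fin 6 → Fin 6 → ℤ :=
  ![![1, 0, 0, 0, 0, 0], ![1, 1, 1, 0, 0, 0], ![1, 1, 1, 0, 0, 0],
    ![1, 0, 0, 1, 0, 0], ![1, 0, 0, 0, 1, 0], ![1, 0, 0, 0, 0, 1]]

theorem hat_order_two (i : Fin 6) (h1 : e6 i ≠ 1) (h2 : e6 i ^ 2 = 1) :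
    hat (e6 i) = E6 (Pi.single 0 1 + Pi.single i 1) := by
  have : orderOf (e6 i) = 2 := orderOf_eq_prime h2 h1
  rw [hat, this, Finset.sum_range_succ, Finset.sum_range_one, pow_zero, pow_one, E6_of, E6_one,
    E6_add]

theorem hat_order_three (i : Fin 6) (h1 : e6 i ≠ 1) (h2 : e6 i ^ 3 = 1) :
    hat (e6 i) = E6 (Pi.single 0 1 + Pi.single i 1 + Pi.single (m6 i i) 1) := by
  have : orderOf (e6 i) = 3 := by
    have : Fact (Nat.Prime 3) := ⟨Nat.prime_three⟩
    exact orderOf_eq_prime h2 h1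
  rw [hat, this, Finset.sum_range_succ, Finset.sum_range_succ, Finset.sum_range_one, pow_zero,
    pow_one, pow_two, ← map_mul, e6_mul, E6_of, E6_of, E6_one, E6_add, E6_add]

theorem hat_e6 (i : Fin 6) : hat (e6 i) = E6 (hat6 i) := by
  fin_cases i
  · have : e6 0 = 1 := rfl
    change hat (e6 0) = _
    rw [this, hat, orderOf_one, Finset.sum_range_one, pow_zero, E6_one]
    congr 1
    decide
  · refine (hat_order_three 1 (by decide) (by decide)).trans ?_
    congr 1
    decide
  · refine (hat_order_three 2 (by decide) (by decide)).trans ?_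
    congr 1
    decide
  · refine (hat_order_two 3 (by decide) (by decide)).trans ?_
    congr 1
    decide
  · refine (hat_order_two 4 (by decide) (by decide)).trans ?_
    congr 1
    decide
  · refine (hat_order_two 5 (by decide) (by decide)).trans ?_
    congr 1
    decide

/-- Coefficients of `β_{x,h} - 1`. -/
def beta6 (x h : Fin 6) : Fin 6 → ℤ :=
  conv6 (conv6 (Pi.single 0 1 - Pi.single h 1) (Pi.single x 1)) (hat6 h)

/-- Coefficients of `γ_{x,h} - 1`. -/
def gamma6 (x h : Fin 6) : Fin 6 → ℤ :=
  conv6 (conv6 (hat6 h) (Pi.single x 1)) (Pi.single 0 1 - Pi.single h 1)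

theorem bicyclicBeta_eq (x h : Fin 6) : bicyclicBeta (e6 x) (e6 h) = 1 + E6 (beta6 x h) := by
  rw [bicyclicBeta, beta6, hat_e6, ← E6_mul, ← E6_mul, ← E6_sub, ← E6_one, ← E6_of, ← E6_of]

theorem bicyclicGamma_eq (x h : Fin 6) : bicyclicGamma (e6 x) (e6 h) = 1 + E6 (gamma6 x h) := by
  rw [bicyclicGamma, gamma6, hat_e6, ← E6_mul, ← E6_mul, ← E6_sub, ← E6_one, ← E6_of, ← E6_of]

/-- Representatives, up to sign, of the nonzero square-zero parts of bicyclic units. -/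
def rep6 (i : Fin 3) (t : Bool) : Fin 6 → ℤ :=
  if t then beta6 1 (![3, 4, 5] i) else gamma6 1 (![3, 4, 5] i)

theorem classify_beta : ∀ x h : Fin 6, beta6 x h = 0 ∨
    ∃ i t, beta6 x h = rep6 i t ∨ beta6 x h = - rep6 i t := by decide +kernel

theorem classify_gamma : ∀ x h : Fin 6, gamma6 x h = 0 ∨
    ∃ i t, gamma6 x h = rep6 i t ∨ gamma6 x h = - rep6 i t := by decide +kernel

theorem rep6_sq : ∀ i t, conv6 (rep6 i t) (rep6 i t) = 0 := by decide +kernel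

theorem rep6_prod : ∀ i t j t', conv6 (rep6 i t) (rep6 j t') = 0 ∨
    ∃ s ∈ [3, -3, 9, -9, 12, -12], conv6 (conv6 (rep6 i t) (rep6 j t')) (rep6 i t)
      = (s : ℤ) • rep6 i t := by decide +kernel

theorem bicyclic_form (u : MonoidAlgebra ℤ S3) (hu : IsBicyclicUnit u) :
    u - 1 = 0 ∨ ∃ i t, ∃ ε : ℤ, (ε = 1 ∨ ε = -1) ∧ u - 1 = ε • E6 (rep6 i t) := by
  obtain ⟨x, h, hxh⟩ := hu
  obtain ⟨x, rfl⟩ := e6_surj x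
  obtain ⟨h, rfl⟩ := e6_surj h
  have key : ∃ f, u = 1 + E6 f ∧ (f = 0 ∨ ∃ i t, f = rep6 i t ∨ f = - rep6 i t) := by
    rcases hxh with h' | h'
    · exact ⟨_, h'.trans (bicyclicBeta_eq x h), classify_beta x h⟩
    · exact ⟨_, h'.trans (bicyclicGamma_eq x h), classify_gamma x h⟩
  obtain ⟨f, hf, h0 | ⟨i, t, h1 | h1⟩⟩ := key
  · left
    rw [hf, h0, E6_zero]
    simp
  · exact Or.inr ⟨i, t, 1, Or.inl rfl, by rw [hf, h1, one_smul, add_sub_cancel_left]⟩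
  · refine Or.inr ⟨i, t, -1, Or.inr rfl, ?_⟩
    rw [hf, h1, add_sub_cancel_left, E6_smul, neg_one_smul]

theorem part_one (α β : (MonoidAlgebra ℤ S3)ˣ)
    (hα : IsBicyclicUnit (α : MonoidAlgebra ℤ S3)) (hβ : IsBicyclicUnit (β : MonoidAlgebra ℤ S3))
    (hn : ¬ IsNilpotent (((α : MonoidAlgebra ℤ S3) - 1) * ((β : MonoidAlgebra ℤ S3) - 1))) :
    IsFreePair α (β ^ 2) := by
  rcases bicyclic_form _ hα with h | ⟨i, t, ε, hε, h⟩
  · exact absurd (by rw [h, zero_mul]; exact IsNilpotent.zero) hn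
  rcases bicyclic_form _ hβ with h' | ⟨j, t', δ, hδ, h'⟩
  · exact absurd (by rw [h', mul_zero]; exact IsNilpotent.zero) hn
  have sq : ∀ i t, E6 (rep6 i t) * E6 (rep6 i t) = 0 := fun i t => by
    rw [E6_mul, rep6_sq, E6_zero]
  rcases rep6_prod i t j t' with hp | ⟨s, hs, hp⟩
  · refine absurd ?_ hn
    rw [h, h', smul_mul_smul_comm, E6_mul, hp, E6_zero, smul_zero]
    exact IsNilpotent.zero
  have hp' : E6 (rep6 i t) * E6 (rep6 j t') * E6 (rep6 i t) = s • E6 (rep6 i t) := by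
    rw [E6_mul, E6_mul, hp, E6_smul]
  have hs2 : 2 ≤ |s| := by
    simp only [List.mem_cons, List.not_mem_nil, or_false] at hs
    rcases hs with rfl | rfl | rfl | rfl | rfl | rfl <;> norm_num
  refine freePair_of_trace ZS3_torsionFree α β _ _ (add_sub_cancel _ _).symm
    (add_sub_cancel _ _).symm ?_ ?_ (ε * δ * s) ?_ ?_ ?_
  · rw [h, smul_mul_smul_comm, sq, smul_zero]
  · rw [h', smul_mul_smul_comm, sq, smul_zero]
  · rcases hε with rfl | rfl <;> rcases hδ with rfl | rfl <;> simpa using hs2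
  · rw [h, h', smul_mul_smul_comm, smul_mul_smul_comm, hp', smul_smul, smul_smul]
    congr 1
    ring
  · intro h0
    exact hn (by rw [h0, zero_mul]; exact IsNilpotent.zero)

/-- Unit with square-zero part. -/
def unitOfSq {R : Type*} [Ring R] (a : R) (ha : a * a = 0) : Rˣ where
  val := 1 + a
  inv := 1 - a
  val_inv := by rw [add_mul, mul_sub, mul_sub, ha]; simp
  inv_val := by rw [sub_mul, mul_add, mul_add, ha]; simp

theorem part_two : ∃ α β : (MonoidAlgebra ℤ S3)ˣ,
      IsBicyclicUnit (α : MonoidAlgebra ℤ S3) ∧ IsBicyclicUnit (β : MonoidAlgebra ℤ S3) ∧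
      ¬ IsNilpotent (((α : MonoidAlgebra ℤ S3) - 1) * ((β : MonoidAlgebra ℤ S3) - 1)) ∧
      ¬ IsFreePair α β := by
  have ha : E6 (gamma6 1 3) * E6 (gamma6 1 3) = 0 := by
    rw [E6_mul, ← E6_zero]; congr 1; decide +kernel
  have hb : E6 (beta6 1 4) * E6 (beta6 1 4) = 0 := by
    rw [E6_mul, ← E6_zero]; congr 1; decide +kernel
  have haba : E6 (gamma6 1 3) * E6 (beta6 1 4) * E6 (gamma6 1 3) = (-3 : ℤ) • E6 (gamma6 1 3) := by
    rw [E6_mul, E6_mul, E6_smul]; congr 1; decide +kernel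
  have ha0 : E6 (gamma6 1 3) ≠ 0 := by
    intro h
    have h1 : gamma6 1 3 = 0 := by
      funext k
      exact (E6_coeff _ k).symm.trans (by rw [h]; rfl)
    revert h1
    decide +kernel
  refine ⟨unitOfSq _ ha, unitOfSq _ hb, ⟨e6 1, e6 3, Or.inr (bicyclicGamma_eq 1 3).symm⟩,
    ⟨e6 1, e6 4, Or.inl (bicyclicBeta_eq 1 4).symm⟩, ?_, ?_⟩
  · change ¬ IsNilpotent ((1 + E6 (gamma6 1 3) - 1) * (1 + E6 (beta6 1 4) - 1))
    rw [add_sub_cancel_left, add_sub_cancel_left]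
    rintro ⟨n, hn⟩
    have hpow : ∀ n : ℕ, (E6 (gamma6 1 3) * E6 (beta6 1 4)) ^ n * E6 (gamma6 1 3)
        = ((-3 : ℤ) ^ n) • E6 (gamma6 1 3) := by
      intro n
      induction n with
      | zero => simp
      | succ n ih =>
        rw [pow_succ, mul_assoc, haba, mul_smul_comm, ih, smul_smul, pow_succ, mul_comm]
    have := hpow n
    rw [hn, zero_mul] at this
    rcases ZS3_torsionFree _ _ this.symm with h | h
    · exact absurd h (pow_ne_zero _ (by norm_num))
    · exact ha0 h
  · intro hfree
    have hrel : (unitOfSq _ ha * unitOfSq _ hb) ^ 3 = 1 := by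
      apply Units.ext
      change ((1 + E6 (gamma6 1 3)) * (1 + E6 (beta6 1 4))) ^ 3 = 1
      rw [pow_succ, pow_two, E6_one]
      simp only [E6_add, E6_mul]
      congr 1
      decide +kernel
    have hw : (FreeGroup.of true * FreeGroup.of false) ^ 3 = (1 : FreeGroup Bool) := by
      apply hfree
      rw [map_pow, map_mul, map_one, FreeGroup.lift_apply_of, FreeGroup.lift_apply_of]
      exact hrel
    have h6 := congrArg (FreeGroup.lift (fun _ : Bool => (Multiplicative.ofAdd (1 : ℤ) : Multiplicative ℤ))) hw
    rw [map_pow, map_mul, MonoidHom.map_one, FreeGroup.lift_apply_of, FreeGroup.lift_apply_of] at h6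
    revert h6
    decide

/-- **Example 5.1: `M(S₃) = 2`.**
(i) For every pair of bicyclic units `α = 1 + a`, `β = 1 + b` of `ℤS₃` with `ab` not
nilpotent, `(α, β²)` is a free pair (so `M(S₃) ≤ 2`); and
(ii) there are bicyclic units `α = 1 + a`, `β = 1 + b` of `ℤS₃` with `ab` not nilpotent
such that `(α, β)` is not a free pair (so `M(S₃) > 1`). -/
theorem M_S3_eq_two :
    (∀ α β : (MonoidAlgebra ℤ S3)ˣ,
      IsBicyclicUnit (α : MonoidAlgebra ℤ S3) → IsBicyclicUnit (β : MonoidAlgebra ℤ S3) →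
      ¬ IsNilpotent (((α : MonoidAlgebra ℤ S3) - 1) * ((β : MonoidAlgebra ℤ S3) - 1)) →
      IsFreePair α (β ^ 2)) ∧
    (∃ α β : (MonoidAlgebra ℤ S3)ˣ,
      IsBicyclicUnit (α : MonoidAlgebra ℤ S3) ∧ IsBicyclicUnit (β : MonoidAlgebra ℤ S3) ∧
      ¬ IsNilpotent (((α : MonoidAlgebra ℤ S3) - 1) * ((β : MonoidAlgebra ℤ S3) - 1)) ∧
      ¬ IsFreePair α β) := by
  exact ⟨part_one, part_two⟩
end
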